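/- arXiv:1404.2480 — 11 statements merged into one kernel-verified Lean document; each statement's English description precedes it below -/
import Mathlib

section
/- Let H be a real Hilbert space, ω ∈ ℝ, and Z ⊆ (ω, +∞) a nonempty set. For each λ ∈ Z let R_λ : H → H be an injective map satisfying ⟨R_λ(u) − R_λ(v), u − v⟩ ≥ 0 for all u, v ∈ H, and suppose the nonlinear resolvent identity R_λ(u) = R_μ(u − (λ − μ)R_λ(u)) holds for all λ, μ ∈ Z and all u ∈ H. Then: (a) the range of R_λ is the same set D for every λ ∈ Z; (b) for all λ, μ ∈ Z and every w ∈ D one has R_λ⁻¹(w) − λw = R_μ⁻¹(w) − μw, so that the operator A : D → H, A(w) := R_λ⁻¹(w) − λw, is independent of λ ∈ Z; (c) for every μ ∈ Z, A is monotone of type μ (⟨A(w₁) − A(w₂), w₁ − w₂⟩ ≥ −μ‖w₁ − w₂‖² on D) and the map w ↦ A(w) + μw is a bijection from D onto H. -/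
local notation "⟪" x ", " y "⟫_ℝ" => @inner ℝ _ _ x y

/-- A family of injective monotone maps `R λ`, `λ ∈ Z ⊆ (ω, ∞)`, satisfying the
nonlinear resolvent identity, has a common range `D`, the operator
`A(w) := R λ⁻¹(w) - λ w` is independent of `λ ∈ Z`, and for every `μ ∈ Z` the
operator `A` is monotone of type `μ` and `w ↦ A w + μ w` is a bijection from `D`
onto `H`. -/
theorem statement1
    {H : Type*} [NormedAddCommGroup H] [InnerProductSpace ℝ H] [CompleteSpace H]
    (ω : ℝ) (Z : Set ℝ) (hZ : Z ⊆ Set.Ioi ω) (hZne : Z.Nonempty)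
    (R : ℝ → H → H)
    (hinj : ∀ lam ∈ Z, Function.Injective (R lam))
    (hmono : ∀ lam ∈ Z, ∀ u v : H, 0 ≤ ⟪R lam u - R lam v, u - v⟫_ℝ)
    (hres : ∀ lam ∈ Z, ∀ mu ∈ Z, ∀ u : H,
      R lam u = R mu (u - (lam - mu) • R lam u)) :
    (∀ lam ∈ Z, ∀ mu ∈ Z, Set.range (R lam) = Set.range (R mu)) ∧
    (∀ lam ∈ Z, ∀ mu ∈ Z, ∀ w ∈ Set.range (R lam),
      Function.invFun (R lam) w - lam • w = Function.invFun (R mu) w - mu • w) ∧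
    (∀ lam ∈ Z, ∀ mu ∈ Z,
      (∀ w₁ ∈ Set.range (R lam), ∀ w₂ ∈ Set.range (R lam),
        -mu * ‖w₁ - w₂‖ ^ 2 ≤
          ⟪(Function.invFun (R lam) w₁ - lam • w₁) -
              (Function.invFun (R lam) w₂ - lam • w₂), w₁ - w₂⟫_ℝ) ∧
      Set.BijOn (fun w => (Function.invFun (R lam) w - lam • w) + mu • w)
        (Set.range (R lam)) Set.univ) := by
  have key : ∀ lam ∈ Z, ∀ mu ∈ Z, ∀ w ∈ Set.range (R lam), w ∈ Set.range (R mu) ∧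
      Function.invFun (R lam) w - lam • w = Function.invFun (R mu) w - mu • w := by
    rintro lam hl mu hm _ ⟨u, rfl⟩
    have h := hres lam hl mu hm u
    refine ⟨⟨_, h.symm⟩, ?_⟩
    have h_inv : Function.invFun (R mu) (R lam u) = u - (lam - mu) • R lam u := by
      conv_lhs => rw [h]
      exact Function.leftInverse_invFun (hinj mu hm) _
    rw [h_inv, Function.leftInverse_invFun (hinj lam hl) u]
    module
  have range_eq : ∀ lam ∈ Z, ∀ mu ∈ Z, Set.range (R lam) = Set.range (R mu) :=
    fun lam hl mu hm => Set.Subset.antisymm (fun w hw => (key lam hl mu hm w hw).1)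
      (fun w hw => (key mu hm lam hl w hw).1)
  refine ⟨range_eq, fun lam hl mu hm w hw => (key lam hl mu hm w hw).2,
    fun lam hl mu hm => ⟨?_, ?_⟩⟩
  · intro w₁ h₁ w₂ h₂
    rw [(key lam hl mu hm w₁ h₁).2, (key lam hl mu hm w₂ h₂).2]
    rw [range_eq lam hl mu hm] at h₁ h₂
    obtain ⟨u, rfl⟩ := h₁
    obtain ⟨v, rfl⟩ := h₂
    rw [Function.leftInverse_invFun (hinj mu hm) u, Function.leftInverse_invFun (hinj mu hm) v,
      show u - mu • R mu u - (v - mu • R mu v) = (u - v) - mu • (R mu u - R mu v) by module,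
      inner_sub_left, real_inner_smul_left, real_inner_self_eq_norm_sq, real_inner_comm]
    linarith [hmono mu hm u v]
  · have h_eq : Set.EqOn (Function.invFun (R mu))
        (fun w => (Function.invFun (R lam) w - lam • w) + mu • w) (Set.range (R lam)) := by
      intro w hw
      simp only [(key lam hl mu hm w hw).2, sub_add_cancel]
    refine Set.BijOn.congr ?_ h_eq
    rw [range_eq lam hl mu hm]
    refine ⟨fun _ _ => Set.mem_univ _, ?_, fun u _ =>
      ⟨R mu u, Set.mem_range_self u, Function.leftInverse_invFun (hinj mu hm) u⟩⟩
    rintro _ ⟨u, rfl⟩ _ ⟨v, rfl⟩ h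
    rw [Function.leftInverse_invFun (hinj mu hm) u,
      Function.leftInverse_invFun (hinj mu hm) v] at h
    rw [h]
end

section
/- Let H and h be real Hilbert spaces and λ, μ ∈ ℝ. Let P_λ, P_μ : H → H and G_λ, G_μ : h → H be continuous linear maps, and V_λ, V_μ : h → h maps, satisfying: (i) P_μ ∘ (1 − (λ − μ)P_λ) = P_λ; (ii) (λ − μ) P_μ G_λ = G_μ − G_λ; (iii) (λ − μ) G_μ* P_λ = G_μ* − G_λ* (as maps H → h); (iv) for every ζ ∈ h, V_μ(ζ − (λ − μ)G_μ*(G_λ(V_λ(ζ)))) = V_λ(ζ). Define R_ν(u) := P_ν u + G_ν(V_ν(G_ν* u)) for ν ∈ {λ, μ}. Then the nonlinear resolvent identity R_λ = R_μ ∘ (1 − (λ − μ)R_λ) holds, i.e. R_λ(u) = R_μ(u − (λ − μ)R_λ(u)) for all u ∈ H. -/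
local notation "⟪" x ", " y "⟫_ℝ" => @inner ℝ _ _ x y

/-- Under the compatibility conditions (i)-(iv) linking `P_λ, P_μ, G_λ, G_μ` and
`V_λ, V_μ`, the maps `R_ν(u) := P_ν u + G_ν (V_ν (G_ν* u))` satisfy the nonlinear
resolvent identity `R_λ = R_μ ∘ (1 - (λ - μ) R_λ)`. -/
theorem statement4
    {H : Type*} [NormedAddCommGroup H] [InnerProductSpace ℝ H] [CompleteSpace H]
    {h : Type*} [NormedAddCommGroup h] [InnerProductSpace ℝ h] [CompleteSpace h]
    (lam mu : ℝ)
    (Plam Pmu : H →L[ℝ] H) (Glam Gmu : h →L[ℝ] H)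
    (Vlam Vmu : h → h)
    (h1 : ∀ u : H, Pmu (u - (lam - mu) • Plam u) = Plam u)
    (h2 : ∀ ξ : h, (lam - mu) • Pmu (Glam ξ) = Gmu ξ - Glam ξ)
    (h3 : ∀ u : H, (lam - mu) • (ContinuousLinearMap.adjoint Gmu) (Plam u) =
      (ContinuousLinearMap.adjoint Gmu) u - (ContinuousLinearMap.adjoint Glam) u)
    (h4 : ∀ ζ : h,
      Vmu (ζ - (lam - mu) • (ContinuousLinearMap.adjoint Gmu) (Glam (Vlam ζ))) = Vlam ζ) :
    ∀ u : H,
      Plam u + Glam (Vlam ((ContinuousLinearMap.adjoint Glam) u)) =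
        Pmu (u - (lam - mu) •
            (Plam u + Glam (Vlam ((ContinuousLinearMap.adjoint Glam) u)))) +
          Gmu (Vmu ((ContinuousLinearMap.adjoint Gmu)
            (u - (lam - mu) •
              (Plam u + Glam (Vlam ((ContinuousLinearMap.adjoint Glam) u)))))) := by
  intro u
  set ζ := ContinuousLinearMap.adjoint Glam u with hζ
  have adjoint_eq : ContinuousLinearMap.adjoint Gmu (u - (lam - mu) • (Plam u + Glam (Vlam ζ))) =
      ζ - (lam - mu) • ContinuousLinearMap.adjoint Gmu (Glam (Vlam ζ)) := by
    rw [map_sub, map_smul, map_add, smul_add, h3, ← hζ]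
    abel
  have P_eq : Pmu (u - (lam - mu) • (Plam u + Glam (Vlam ζ))) =
      Plam u - (Gmu (Vlam ζ) - Glam (Vlam ζ)) := by
    rw [smul_add, ← sub_sub, map_sub, h1, map_smul, h2]
  rw [adjoint_eq, h4, P_eq]
  abel
end

section
/- In the standard setting, for every λ > ω the map G_λ : h → H is injective and range(G_λ) ∩ D = {0}; that is, if ξ ∈ h and G_λξ ∈ D then ξ = 0. -/
local notation "⟪" x ", " y "⟫_ℝ" => @inner ℝ _ _ x y

/-- In the standard setting (semi-bounded symmetric `A` on a dense domain `D`,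
resolvents `R lam`, surjective trace map `tau` with dense kernel, and
`G lam := (tau . R lam)*`), for every `lam > omega` the map `G lam` is injective and
`range (G lam) /\ D = {0}`. -/
theorem statement5
    {H : Type*} [NormedAddCommGroup H] [InnerProductSpace ℝ H] [CompleteSpace H]
    {h : Type*} [NormedAddCommGroup h] [InnerProductSpace ℝ h] [CompleteSpace h]
    (ω : ℝ) (D : Submodule ℝ H) (hDdense : Dense (D : Set H))
    (A : D →ₗ[ℝ] H)
    (hAsym : ∀ u v : D, ⟪A u, (v : H)⟫_ℝ = ⟪(u : H), A v⟫_ℝ)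
    (hAbound : ∀ u : D, -ω * ‖(u : H)‖ ^ 2 ≤ ⟪A u, (u : H)⟫_ℝ)
    (R : ℝ → H →L[ℝ] H)
    (hRmem : ∀ lam, ω < lam → ∀ w : H, R lam w ∈ D)
    (hRleft : ∀ lam, ω < lam → ∀ u : D, R lam (A u + lam • (u : H)) = (u : H))
    (hRright : ∀ lam, ∀ hlam : ω < lam, ∀ w : H,
      A ⟨R lam w, hRmem lam hlam w⟩ + lam • R lam w = w)
    (τ : D →ₗ[ℝ] h) (hτsurj : Function.Surjective τ)
    (hτcont : ∃ C : ℝ, ∀ u : D, ‖τ u‖ ≤ C * (‖A u‖ + ‖(u : H)‖))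
    (hτker : Dense (((LinearMap.ker τ).map D.subtype : Submodule ℝ H) : Set H))
    (T : ℝ → H →L[ℝ] h)
    (hT : ∀ lam, ∀ hlam : ω < lam, ∀ w : H, T lam w = τ ⟨R lam w, hRmem lam hlam w⟩)
    (G : ℝ → h →L[ℝ] H)
    (hG : ∀ lam, G lam = ContinuousLinearMap.adjoint (T lam)):
    ∀ lam, ω < lam →
      Function.Injective ⇑(G lam) ∧ ∀ ξ : h, G lam ξ ∈ D → ξ = 0 := by
  intro lam hlam
  have green (ξ : h) (u : D) : ⟪G lam ξ, A u + lam • (u : H)⟫_ℝ = ⟪ξ, τ u⟫_ℝ := by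
    rw [hG, ContinuousLinearMap.adjoint_inner_left, hT lam hlam]
    congr 2
    exact Subtype.ext (hRleft lam hlam u)
  have eq_zero (ξ : h) (hξ : G lam ξ ∈ D) : ξ = 0 := by
    have hker : A ⟨G lam ξ, hξ⟩ + lam • G lam ξ = 0 := by
      refine hτker.eq_zero_of_inner_left ℝ fun w hw => ?_
      obtain ⟨u, hu, rfl⟩ := hw
      have hgreen := green ξ u
      rw [LinearMap.mem_ker.mp hu, inner_zero_right, inner_add_right,
        inner_smul_right] at hgreen
      rw [Submodule.subtype_apply, inner_add_left, real_inner_smul_left,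
        hAsym ⟨G lam ξ, hξ⟩ u, hgreen]
    have hzero : G lam ξ = 0 := by
      have hleft := hRleft lam hlam ⟨G lam ξ, hξ⟩
      rwa [hker, map_zero, eq_comm] at hleft
    obtain ⟨u, hu⟩ := hτsurj ξ
    rw [← inner_self_eq_zero (𝕜 := ℝ)]
    nth_rewrite 2 [← hu]
    rw [← green, hzero, inner_zero_left]
  exact ⟨(injective_iff_map_eq_zero (G lam)).mpr fun ξ hξ =>
    eq_zero ξ (hξ ▸ D.zero_mem), eq_zero⟩
end

section
/- In the standard setting, for all λ, μ > ω and all ξ ∈ h one has (λ − μ) R∘_μ(G_λξ) = G_μξ − G_λξ; in particular (G_μ − G_λ)ξ ∈ D and A∘((G_μ − G_λ)ξ) = λ G_λξ − μ G_μξ. -/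
/-- A right inverse of `A + lam`, for `A` symmetric on `D`, is symmetric. -/
theorem inner_resolvent_comm {H : Type*} [NormedAddCommGroup H] [InnerProductSpace ℝ H]
    {D : Submodule ℝ H} {A : D →ₗ[ℝ] H}
    (hA : ∀ u v : D, inner ℝ (A u) (v : H) = inner ℝ (u : H) (A v))
    {lam : ℝ} {R : H → H} (hmem : ∀ w, R w ∈ D)
    (hright : ∀ w, A ⟨R w, hmem w⟩ + lam • R w = w) (v w : H) :
    inner ℝ (R v) w = inner ℝ v (R w) := by
  calc inner ℝ (R v) w = inner ℝ (R v) (A ⟨R w, hmem w⟩ + lam • R w) := by rw [hright]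
    _ = inner ℝ (A ⟨R v, hmem v⟩ + lam • R v) (R w) := by
      have key := hA ⟨R v, hmem v⟩ ⟨R w, hmem w⟩
      simp only at key
      rw [inner_add_right, inner_add_left, real_inner_smul_left, real_inner_smul_right, key]
    _ = inner ℝ v (R w) := by rw [hright]

/-- The first resolvent identity for one-sided inverses of `A + lam` and `A + mu`. -/
theorem resolvent_sub_resolvent {H : Type*} [AddCommGroup H] [Module ℝ H]
    {D : Submodule ℝ H} {A : D →ₗ[ℝ] H} {lam mu : ℝ} {R : H →ₗ[ℝ] H} {S : H → H}
    (hleft : ∀ u : D, R (A u + lam • (u : H)) = u) (hmem : ∀ w, S w ∈ D)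
    (hright : ∀ w, A ⟨S w, hmem w⟩ + mu • S w = w) (w : H) :
    S w - R w = (lam - mu) • R (S w) := by
  have h₁ : R (A ⟨S w, hmem w⟩ + lam • S w) = S w := hleft ⟨S w, hmem w⟩
  have h₂ : A ⟨S w, hmem w⟩ + lam • S w = w + (lam - mu) • S w := by
    linear_combination (norm := module) hright w
  rw [h₂, map_add, map_smul] at h₁
  rw [sub_eq_iff_eq_add', h₁]


local notation "⟪" x ", " y "⟫_ℝ" => @inner ℝ _ _ x y

theorem statement6
    {H : Type*} [NormedAddCommGroup H] [InnerProductSpace ℝ H] [CompleteSpace H]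
    {h : Type*} [NormedAddCommGroup h] [InnerProductSpace ℝ h] [CompleteSpace h]
    (ω : ℝ) (D : Submodule ℝ H) (hDdense : Dense (D : Set H))
    (A : D →ₗ[ℝ] H)
    (hAsym : ∀ u v : D, ⟪A u, (v : H)⟫_ℝ = ⟪(u : H), A v⟫_ℝ)
    (hAbound : ∀ u : D, -ω * ‖(u : H)‖ ^ 2 ≤ ⟪A u, (u : H)⟫_ℝ)
    (R : ℝ → H →L[ℝ] H)
    (hRmem : ∀ lam, ω < lam → ∀ w : H, R lam w ∈ D)
    (hRleft : ∀ lam, ω < lam → ∀ u : D, R lam (A u + lam • (u : H)) = (u : H))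
    (hRright : ∀ lam, ∀ hlam : ω < lam, ∀ w : H,
      A ⟨R lam w, hRmem lam hlam w⟩ + lam • R lam w = w)
    (τ : D →ₗ[ℝ] h) (hτsurj : Function.Surjective τ)
    (hτcont : ∃ C : ℝ, ∀ u : D, ‖τ u‖ ≤ C * (‖A u‖ + ‖(u : H)‖))
    (hτker : Dense (((LinearMap.ker τ).map D.subtype : Submodule ℝ H) : Set H))
    (T : ℝ → H →L[ℝ] h)
    (hT : ∀ lam, ∀ hlam : ω < lam, ∀ w : H, T lam w = τ ⟨R lam w, hRmem lam hlam w⟩)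
    (G : ℝ → h →L[ℝ] H)
    (hG : ∀ lam, G lam = ContinuousLinearMap.adjoint (T lam)) :
    ∀ lam mu, ω < lam → ω < mu → ∀ ξ : h,
      (lam - mu) • R mu (G lam ξ) = G mu ξ - G lam ξ ∧
      ∃ hmem : G mu ξ - G lam ξ ∈ D,
        A ⟨G mu ξ - G lam ξ, hmem⟩ = lam • G lam ξ - mu • G mu ξ := by
  intro lam mu hlam hmu ξ
  have hTsub (w : H) : T mu w - T lam w = (lam - mu) • T lam (R mu w) := by
    rw [hT mu hmu, hT lam hlam, hT lam hlam, ← map_sub, ← map_smul]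
    congr 1
    ext
    exact resolvent_sub_resolvent (R := (R lam).toLinearMap) (hRleft lam hlam) (hRmem mu hmu)
      (hRright mu hmu) w
  have hGsub : (lam - mu) • R mu (G lam ξ) = G mu ξ - G lam ξ := by
    refine ext_inner_right ℝ fun w => ?_
    rw [hG, hG, inner_sub_left, real_inner_smul_left,
      inner_resolvent_comm hAsym (hRmem mu hmu) (hRright mu hmu),
      ContinuousLinearMap.adjoint_inner_left, ContinuousLinearMap.adjoint_inner_left,
      ContinuousLinearMap.adjoint_inner_left, ← inner_sub_right, hTsub, real_inner_smul_right]
  have hmem : G mu ξ - G lam ξ ∈ D :=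
    hGsub ▸ D.smul_mem _ (hRmem mu hmu _)
  refine ⟨hGsub, hmem, ?_⟩
  have hsub : (⟨G mu ξ - G lam ξ, hmem⟩ : D) =
      (lam - mu) • ⟨R mu (G lam ξ), hRmem mu hmu _⟩ := Subtype.ext hGsub.symm
  rw [hsub, map_smul]
  linear_combination (norm := module) (lam - mu) • hRright mu hmu (G lam ξ) - mu • hGsub
end

section
/- In the standard setting, fix λ∘ > ω and write G∘ := G_{λ∘}. Then for every λ > λ∘ and every ξ ∈ h one has (λ − λ∘)⟨G∘*(G_λξ), ξ⟩ ≥ (λ − λ∘)·((λ∘ − ω)/(λ − ω))·‖G∘ξ‖²; moreover there exists γ₀ > 0 such that ‖G∘ξ‖ ≥ γ₀‖ξ‖ for all ξ ∈ h, and consequently the linear map M∘_λ := (λ − λ∘)G∘*G_λ : h → h satisfies ⟨M∘_λξ, ξ⟩ ≥ ω₀‖ξ‖² with ω₀ := γ₀²(λ − λ∘)(λ∘ − ω)/(λ − ω) > 0. -/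
local notation "⟪" x ", " y "⟫_ℝ" => @inner ℝ _ _ x y

/-- The adjoint of a surjective bounded operator between Hilbert spaces is bounded below. -/
theorem exists_pos_mul_norm_le_norm_adjoint_of_surjective
    {E F : Type*} [NormedAddCommGroup E] [InnerProductSpace ℝ E] [CompleteSpace E]
    [NormedAddCommGroup F] [InnerProductSpace ℝ F] [CompleteSpace F]
    (T : E →L[ℝ] F) (hT : Function.Surjective T) :
    ∃ c : ℝ, 0 < c ∧ ∀ y : F, c * ‖y‖ ≤ ‖ContinuousLinearMap.adjoint T y‖ := by
  obtain ⟨C, hC, hpre⟩ := T.exists_preimage_norm_le hT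
  refine ⟨C⁻¹, inv_pos.2 hC, fun y => ?_⟩
  rw [inv_mul_le_iff₀ hC]
  obtain ⟨x, rfl, hx⟩ := hpre y
  rcases (norm_nonneg (T x)).eq_or_lt with h0 | hpos
  · rw [← h0]
    positivity
  · refine le_of_mul_le_mul_right ?_ hpos
    calc ‖T x‖ * ‖T x‖ = ⟪x, ContinuousLinearMap.adjoint T (T x)⟫_ℝ := by
          rw [ContinuousLinearMap.adjoint_inner_right, real_inner_self_eq_norm_mul_norm]
      _ ≤ ‖x‖ * ‖ContinuousLinearMap.adjoint T (T x)‖ := real_inner_le_norm _ _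
      _ ≤ C * ‖T x‖ * ‖ContinuousLinearMap.adjoint T (T x)‖ := by gcongr
      _ = C * ‖ContinuousLinearMap.adjoint T (T x)‖ * ‖T x‖ := by ring

/-- If `⟪u, w⟫ ≥ c ‖u‖²` with `c > 0`, then `⟪u, w⟫ ≤ ‖w‖² / c`. -/
theorem mul_inner_le_norm_sq_of_mul_norm_sq_le_inner
    {E : Type*} [NormedAddCommGroup E] [InnerProductSpace ℝ E] {c : ℝ} (hc : 0 < c) {u w : E}
    (huw : c * ‖u‖ ^ 2 ≤ ⟪u, w⟫_ℝ) : c * ⟪u, w⟫_ℝ ≤ ‖w‖ ^ 2 := by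
  have hsq : ‖w - c • u‖ ^ 2 = ‖w‖ ^ 2 - 2 * (c * ⟪u, w⟫_ℝ) + c * (c * ‖u‖ ^ 2) := by
    rw [norm_sub_sq_real, inner_smul_right, norm_smul, Real.norm_of_nonneg hc.le,
      real_inner_comm]
    ring
  nlinarith [sq_nonneg ‖w - c • u‖, mul_le_mul_of_nonneg_left huw hc.le]

theorem statement7
    {H : Type*} [NormedAddCommGroup H] [InnerProductSpace ℝ H] [CompleteSpace H]
    {h : Type*} [NormedAddCommGroup h] [InnerProductSpace ℝ h] [CompleteSpace h]
    (ω : ℝ) (D : Submodule ℝ H) (hDdense : Dense (D : Set H))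
    (A : D →ₗ[ℝ] H)
    (hAsym : ∀ u v : D, ⟪A u, (v : H)⟫_ℝ = ⟪(u : H), A v⟫_ℝ)
    (hAbound : ∀ u : D, -ω * ‖(u : H)‖ ^ 2 ≤ ⟪A u, (u : H)⟫_ℝ)
    (R : ℝ → H →L[ℝ] H)
    (hRmem : ∀ lam, ω < lam → ∀ w : H, R lam w ∈ D)
    (hRleft : ∀ lam, ω < lam → ∀ u : D, R lam (A u + lam • (u : H)) = (u : H))
    (hRright : ∀ lam, ∀ hlam : ω < lam, ∀ w : H,
      A ⟨R lam w, hRmem lam hlam w⟩ + lam • R lam w = w)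
    (τ : D →ₗ[ℝ] h) (hτsurj : Function.Surjective τ)
    (hτcont : ∃ C : ℝ, ∀ u : D, ‖τ u‖ ≤ C * (‖A u‖ + ‖(u : H)‖))
    (hτker : Dense (((LinearMap.ker τ).map D.subtype : Submodule ℝ H) : Set H))
    (T : ℝ → H →L[ℝ] h)
    (hT : ∀ lam, ∀ hlam : ω < lam, ∀ w : H, T lam w = τ ⟨R lam w, hRmem lam hlam w⟩)
    (G : ℝ → h →L[ℝ] H)
    (hG : ∀ lam, G lam = ContinuousLinearMap.adjoint (T lam))
    (lam0 : ℝ) (hlam0 : ω < lam0) :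
    (∀ lam, lam0 < lam → ∀ ξ : h,
      (lam - lam0) * ((lam0 - ω) / (lam - ω)) * ‖G lam0 ξ‖ ^ 2 ≤
        (lam - lam0) * ⟪(ContinuousLinearMap.adjoint (G lam0)) (G lam ξ), ξ⟫_ℝ) ∧
    ∃ γ0 : ℝ, 0 < γ0 ∧ (∀ ξ : h, γ0 * ‖ξ‖ ≤ ‖G lam0 ξ‖) ∧
      ∀ lam, lam0 < lam →
        0 < γ0 ^ 2 * (lam - lam0) * ((lam0 - ω) / (lam - ω)) ∧
        ∀ ξ : h,
          γ0 ^ 2 * (lam - lam0) * ((lam0 - ω) / (lam - ω)) * ‖ξ‖ ^ 2 ≤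
            ⟪(lam - lam0) • (ContinuousLinearMap.adjoint (G lam0)) (G lam ξ), ξ⟫_ℝ := by
  have hRacc : ∀ lam, ω < lam → ∀ w : H, (lam - ω) * ‖R lam w‖ ^ 2 ≤ ⟪R lam w, w⟫_ℝ := by
    intro lam hlam w
    have hb := hAbound ⟨R lam w, hRmem lam hlam w⟩
    have hw : ⟪R lam w, w⟫_ℝ = ⟪R lam w, A ⟨R lam w, hRmem lam hlam w⟩⟫_ℝ
        + lam * ‖R lam w‖ ^ 2 := by
      rw [← real_inner_self_eq_norm_sq, ← inner_smul_right (𝕜 := ℝ), ← inner_add_right,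
        hRright lam hlam w]
    rw [real_inner_comm] at hb
    dsimp only at hb
    linarith
  have hTresolvent : ∀ lam, lam0 < lam → ∀ w : H,
      T lam w = T lam0 (w - (lam - lam0) • R lam w) := by
    intro lam hlam w
    rw [hT lam (hlam0.trans hlam), hT lam0 hlam0]
    congr 1
    apply Subtype.ext
    have hl := hRleft lam0 hlam0 ⟨R lam w, hRmem lam (hlam0.trans hlam) w⟩
    have hr := hRright lam (hlam0.trans hlam) w
    dsimp only at hl ⊢
    conv_lhs => rw [← hl]
    congr 1
    rw [eq_sub_of_add_eq hr, sub_smul]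
    abel
  have hTsurj : Function.Surjective (T lam0) := by
    intro y
    obtain ⟨u, rfl⟩ := hτsurj y
    refine ⟨A u + lam0 • (u : H), ?_⟩
    rw [hT lam0 hlam0]
    congr 1
    exact Subtype.ext (hRleft lam0 hlam0 u)
  have hGform : ∀ lam, lam0 < lam → ∀ ξ : h,
      (lam0 - ω) / (lam - ω) * ‖G lam0 ξ‖ ^ 2 ≤
        ⟪(ContinuousLinearMap.adjoint (G lam0)) (G lam ξ), ξ⟫_ℝ := by
    intro lam hlam ξ
    have hpos : 0 < lam - ω := by linarith
    have hform : ⟪(ContinuousLinearMap.adjoint (G lam0)) (G lam ξ), ξ⟫_ℝ =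
        ‖G lam0 ξ‖ ^ 2 - (lam - lam0) * ⟪R lam (G lam0 ξ), G lam0 ξ⟫_ℝ := by
      rw [ContinuousLinearMap.adjoint_inner_left, hG lam,
        ContinuousLinearMap.adjoint_inner_left, hTresolvent lam hlam,
        ← ContinuousLinearMap.adjoint_inner_left, ← hG lam0, inner_sub_right,
        inner_smul_right, real_inner_self_eq_norm_sq, real_inner_comm (G lam0 ξ)]
    have hR := mul_inner_le_norm_sq_of_mul_norm_sq_le_inner hpos
      (hRacc lam (hlam0.trans hlam) (G lam0 ξ))
    rw [hform, div_mul_eq_mul_div, div_le_iff₀ hpos]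
    nlinarith [mul_le_mul_of_nonneg_left hR (sub_pos.2 hlam).le]
  refine ⟨fun lam hlam ξ => ?_, ?_⟩
  · rw [mul_assoc]
    exact mul_le_mul_of_nonneg_left (hGform lam hlam ξ) (sub_pos.2 hlam).le
  · obtain ⟨γ0, hγ0, hγ⟩ := exists_pos_mul_norm_le_norm_adjoint_of_surjective (T lam0) hTsurj
    rw [← hG lam0] at hγ
    refine ⟨γ0, hγ0, hγ, fun lam hlam => ?_⟩
    have h1 : 0 < lam - lam0 := sub_pos.2 hlam
    have h2 : 0 < (lam0 - ω) / (lam - ω) :=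
      div_pos (sub_pos.2 hlam0) (sub_pos.2 (hlam0.trans hlam))
    refine ⟨by positivity, fun ξ => ?_⟩
    rw [real_inner_smul_left]
    calc γ0 ^ 2 * (lam - lam0) * ((lam0 - ω) / (lam - ω)) * ‖ξ‖ ^ 2
        = (lam - lam0) * ((lam0 - ω) / (lam - ω) * (γ0 * ‖ξ‖) ^ 2) := by ring
      _ ≤ (lam - lam0) * ((lam0 - ω) / (lam - ω) * ‖G lam0 ξ‖ ^ 2) := by
          gcongr
          exact hγ ξ
      _ ≤ _ := mul_le_mul_of_nonneg_left (hGform lam hlam ξ) h1.le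
end

section
/- In the standard setting, fix λ∘ > ω, write G∘ := G_{λ∘}, and let Θ ⊆ h × h be a maximal monotone relation. For λ > λ∘ define M^Θ_λ := {(ξ, ξ' + (λ − λ∘)G∘*(G_λξ)) : (ξ, ξ') ∈ Θ}. Then there exists ω₀ > 0 such that M^Θ_λ is a maximal monotone relation of type −ω₀, and for every ζ ∈ h there exists exactly one ξ ∈ h with (ξ, ζ) ∈ M^Θ_λ; thus (M^Θ_λ)⁻¹ : h → h is an everywhere-defined, single-valued, monotone map. Moreover, for λ, μ > λ∘ one has (ξ, ξ') ∈ M^Θ_μ if and only if (ξ, ξ' + (λ − μ)G_μ*(G_λξ)) ∈ M^Θ_λ. -/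
local notation "⟪" x ", " y "⟫_ℝ" => @inner ℝ _ _ x y

/-- A relation `Θ ⊆ h × h` is monotone of type `w` if
`⟪ξ' - ζ', ξ - ζ⟫ ≥ -w * ‖ξ - ζ‖²` for all `(ξ, ξ'), (ζ, ζ') ∈ Θ`. -/
def MonotoneRelOfType {h : Type*} [NormedAddCommGroup h] [InnerProductSpace ℝ h]
    (w : ℝ) (Θ : Set (h × h)) : Prop :=
  ∀ p ∈ Θ, ∀ q ∈ Θ, -w * ‖p.1 - q.1‖ ^ 2 ≤ ⟪p.2 - q.2, p.1 - q.1⟫_ℝ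

/-- A relation is maximal monotone of type `w` if it is monotone of type `w` and
not properly contained in any other monotone relation of type `w`. -/
def MaximalMonotoneRelOfType {h : Type*} [NormedAddCommGroup h] [InnerProductSpace ℝ h]
    (w : ℝ) (Θ : Set (h × h)) : Prop :=
  MonotoneRelOfType w Θ ∧
    ∀ Θ' : Set (h × h), MonotoneRelOfType w Θ' → Θ ⊆ Θ' → Θ' = Θ

/-- The shifted relation `M^Θ_λ = Θ + (λ - λ∘) G∘* G_λ`. -/
def MTheta {H : Type*} {h : Type*} [NormedAddCommGroup H] [InnerProductSpace ℝ H]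
    [CompleteSpace H] [NormedAddCommGroup h] [InnerProductSpace ℝ h] [CompleteSpace h]
    (G : ℝ → h →L[ℝ] H) (lam0 lam : ℝ) (Θ : Set (h × h)) : Set (h × h) :=
  (fun p : h × h =>
    (p.1, p.2 + (lam - lam0) • (ContinuousLinearMap.adjoint (G lam0)) (G lam p.1))) '' Θ

/-- On a nonempty closed convex set of pairs `(x, t)`, if `t + ‖x‖² / 2` is bounded below then it
attains its minimum, and the minimiser satisfies the first-order variational inequality. -/
lemma exists_variational_minimizer {E : Type*} [NormedAddCommGroup E] [InnerProductSpace ℝ E]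
    [CompleteSpace E] {S : Set (E × ℝ)} (hne : S.Nonempty) (hcl : IsClosed S) (hconv : Convex ℝ S)
    (hbd : ∀ p ∈ S, 0 ≤ p.2 + ‖p.1‖ ^ 2 / 2) :
    ∃ p ∈ S, ∀ q ∈ S, 0 ≤ q.2 - p.2 + ⟪p.1, q.1 - p.1⟫_ℝ := by
  set f : E × ℝ → ℝ := fun p => p.2 + ‖p.1‖ ^ 2 / 2 with hf
  have hfc : Continuous f := by fun_prop
  set m := sInf (f '' S) with hm
  have hbdd : BddBelow (f '' S) := ⟨0, by rintro _ ⟨p, hp, rfl⟩; exact hbd p hp⟩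
  have hmle : ∀ p ∈ S, m ≤ f p := fun p hp => csInf_le hbdd ⟨p, hp, rfl⟩
  have hex : ∀ n : ℕ, ∃ p ∈ S, f p < m + 1 / ((n : ℝ) + 1) := by
    intro n
    obtain ⟨_, ⟨p, hp, rfl⟩, hlt⟩ :=
      exists_lt_of_csInf_lt (hne.image f) (lt_add_of_pos_right m (Nat.one_div_pos_of_nat (n := n)))
    exact ⟨p, hp, hlt⟩
  choose x hxS hxlt using hex
  have hmid : ∀ p ∈ S, ∀ q ∈ S, ‖p.1 - q.1‖ ^ 2 ≤ 4 * (f p - m) + 4 * (f q - m) := by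
    intro p hp q hq
    have h1 := hmle _ (hconv hp hq (a := 1 / 2) (b := 1 / 2) (by norm_num) (by norm_num)
      (by norm_num))
    have h2 : ‖(1 / 2 : ℝ) • p.1 + (1 / 2 : ℝ) • q.1‖ ^ 2
        = ‖p.1‖ ^ 2 / 2 + ‖q.1‖ ^ 2 / 2 - ‖p.1 - q.1‖ ^ 2 / 4 := by
      rw [norm_add_sq_real, norm_sub_sq_real, norm_smul, norm_smul, inner_smul_left,
        inner_smul_right]
      norm_num
      ring
    simp only [hf, Prod.fst_add, Prod.snd_add, Prod.smul_fst, Prod.smul_snd, smul_eq_mul, h2]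
      at h1 ⊢
    linarith
  have hlim0 : Filter.Tendsto (fun n : ℕ => 1 / ((n : ℝ) + 1)) Filter.atTop (nhds 0) :=
    tendsto_one_div_add_atTop_nhds_zero_nat
  have hcauchy : CauchySeq fun n => (x n).1 := by
    refine cauchySeq_of_le_tendsto_0 (fun n : ℕ => √(8 * (1 / ((n : ℝ) + 1)))) ?_ ?_
    · intro n k N hn hk
      rw [dist_eq_norm]
      apply Real.le_sqrt_of_sq_le
      have h1 := hmid _ (hxS n) _ (hxS k)
      have h2 := Nat.one_div_le_one_div (α := ℝ) hn
      have h3 := Nat.one_div_le_one_div (α := ℝ) hk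
      linarith [hxlt n, hxlt k]
    · simpa using (hlim0.const_mul 8).sqrt
  obtain ⟨a, ha⟩ := cauchySeq_tendsto_of_complete hcauchy
  have hfx : Filter.Tendsto (fun n => f (x n)) Filter.atTop (nhds m) := by
    refine tendsto_of_tendsto_of_tendsto_of_le_of_le tendsto_const_nhds ?_
      (fun n => hmle _ (hxS n)) (fun n => (hxlt n).le)
    simpa using hlim0.const_add m
  have hsnd : Filter.Tendsto (fun n => (x n).2) Filter.atTop (nhds (m - ‖a‖ ^ 2 / 2)) := by
    have := hfx.sub ((ha.norm.pow 2).div_const 2)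
    simpa [hf] using this
  have hlim : Filter.Tendsto x Filter.atTop (nhds (a, m - ‖a‖ ^ 2 / 2)) := by
    simpa using ha.prodMk_nhds hsnd
  have haS := hcl.mem_of_tendsto hlim (Filter.Eventually.of_forall hxS)
  refine ⟨_, haS, fun q hq => ?_⟩
  by_contra! hneg
  set p : E × ℝ := (a, m - ‖a‖ ^ 2 / 2) with hp
  set V := q.2 - p.2 + ⟪p.1, q.1 - p.1⟫_ℝ with hV
  set N := ‖q.1 - p.1‖ ^ 2 with hN
  have hN0 : 0 ≤ N := by positivity
  set t := min 1 (-V / (N + 1)) with ht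
  have ht0 : 0 < t := lt_min one_pos (div_pos (by linarith) (by linarith))
  have ht1 : t ≤ 1 := min_le_left _ _
  have ht2 : t * (N + 1) ≤ -V := (le_div_iff₀ (by linarith)).1 (min_le_right _ _)
  have hmem := hconv.add_smul_sub_mem haS hq ⟨ht0.le, ht1⟩
  have h1 := hmle _ hmem
  have hexp : f (p + t • (q - p)) = m + t * V + t ^ 2 * N / 2 := by
    simp only [hf, Prod.fst_add, Prod.snd_add, Prod.smul_fst, Prod.smul_snd, smul_eq_mul,
      Prod.fst_sub, Prod.snd_sub, norm_add_sq_real, norm_smul, inner_smul_right, hV, hN, mul_pow,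
      Real.norm_eq_abs, sq_abs]
    simp only [hp]
    ring
  rw [hexp] at h1
  nlinarith

section Minty

variable {h : Type*} [NormedAddCommGroup h] [InnerProductSpace ℝ h]

lemma MaximalMonotoneRelOfType.mem_of_forall {Θ : Set (h × h)}
    (hΘ : MaximalMonotoneRelOfType 0 Θ) {x x' : h}
    (hx : ∀ q ∈ Θ, 0 ≤ ⟪x' - q.2, x - q.1⟫_ℝ) : (x, x') ∈ Θ := by
  have hmono : MonotoneRelOfType 0 (insert (x, x') Θ) := by
    rintro p (rfl | hp) q (rfl | hq)
    · simp
    · simpa using hx q hq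
    · have := hx p hp
      rw [← neg_sub, ← neg_sub p.1, inner_neg_neg] at this
      simpa using this
    · exact hΘ.1 p hp q hq
  rw [← hΘ.2 _ hmono (Set.subset_insert _ _)]
  exact Set.mem_insert _ _

lemma MaximalMonotoneRelOfType.nonempty {Θ : Set (h × h)}
    (hΘ : MaximalMonotoneRelOfType 0 Θ) : Θ.Nonempty := by
  by_contra hne
  rw [Set.not_nonempty_iff_eq_empty] at hne
  have := hΘ.mem_of_forall (x := 0) (x' := 0) (by simp [hne])
  simp [hne] at this

/-- Maximal monotonicity is invariant under translation of the values and positive scaling. -/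
lemma MaximalMonotoneRelOfType.preimage_affine {Θ : Set (h × h)}
    (hΘ : MaximalMonotoneRelOfType 0 Θ) {r : ℝ} (hr : 0 < r) (c : h) :
    MaximalMonotoneRelOfType 0 {p : h × h | (p.1, r • p.2 + c) ∈ Θ} := by
  constructor
  · intro p hp q hq
    have := hΘ.1 _ hp _ hq
    simp only [add_sub_add_right_eq_sub, ← smul_sub, inner_smul_left] at this
    simp only [neg_zero, zero_mul] at this ⊢
    exact nonneg_of_mul_nonneg_right this hr
  · intro Θ' hΘ' hsub
    refine Set.Subset.antisymm (fun p hp => hΘ.mem_of_forall fun q hq => ?_) hsub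
    have hq' : (q.1, r⁻¹ • (q.2 - c)) ∈ Θ' := hsub (by
      simpa [smul_smul, hr.ne'] using hq)
    have h1 := hΘ' _ hp _ hq'
    have h2 : r • p.2 + c - q.2 = r • (p.2 - r⁻¹ • (q.2 - c)) := by
      rw [smul_sub, smul_smul, mul_inv_cancel₀ hr.ne', one_smul]
      abel
    rw [h2, inner_smul_left]
    simp only [neg_zero, zero_mul] at h1
    exact mul_nonneg hr.le h1

variable [CompleteSpace h]

/-- **Minty's theorem** at the origin, proved by minimising the Fitzpatrick function plus half the
squared norm. -/
lemma MaximalMonotoneRelOfType.exists_neg_mem {Θ : Set (h × h)}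
    (hΘ : MaximalMonotoneRelOfType 0 Θ) : ∃ x, (x, -x) ∈ Θ := by
  set S : Set (WithLp 2 (h × h) × ℝ) :=
    {p | ∀ y ∈ Θ, ⟪p.1.fst, y.2⟫_ℝ + ⟪y.1, p.1.snd⟫_ℝ - ⟪y.1, y.2⟫_ℝ ≤ p.2} with hS
  have hmemS : ∀ y ∈ Θ, (WithLp.toLp 2 y, ⟪y.1, y.2⟫_ℝ) ∈ S := by
    intro y hy z hz
    have := hΘ.1 y hy z hz
    simp only [inner_sub_left, inner_sub_right, neg_zero, zero_mul] at this
    simp only [WithLp.toLp_fst, WithLp.toLp_snd]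
    linarith [real_inner_comm y.1 y.2, real_inner_comm y.1 z.2, real_inner_comm z.1 y.2,
      real_inner_comm z.1 z.2]
  have hfitz : ∀ p ∈ S, ⟪p.1.fst, p.1.snd⟫_ℝ ≤ p.2 := by
    intro p hp
    by_contra! hlt
    have hmem : (p.1.fst, p.1.snd) ∈ Θ := hΘ.mem_of_forall fun q hq => by
      have := hp q hq
      simp only [inner_sub_left, inner_sub_right]
      linarith [real_inner_comm p.1.fst p.1.snd, real_inner_comm p.1.fst q.2,
        real_inner_comm q.1 p.1.snd, real_inner_comm q.1 q.2]
    have := hp _ hmem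
    simp only at this
    linarith
  have hne : S.Nonempty := let ⟨y, hy⟩ := hΘ.nonempty; ⟨_, hmemS y hy⟩
  have hcl : IsClosed S := by
    rw [hS]
    simp only [Set.ofPred_forall]
    refine isClosed_iInter fun y => isClosed_iInter fun _ => isClosed_le ?_ continuous_snd
    fun_prop
  have hconv : Convex ℝ S := by
    intro p hp q hq a b ha hb hab y hy
    have h1 := mul_le_mul_of_nonneg_left (hp y hy) ha
    have h2 := mul_le_mul_of_nonneg_left (hq y hy) hb
    simp only [Prod.fst_add, Prod.snd_add, Prod.smul_fst, Prod.smul_snd, smul_eq_mul,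
      WithLp.add_fst, WithLp.add_snd, WithLp.smul_fst, WithLp.smul_snd, inner_add_left,
      inner_add_right, inner_smul_left, inner_smul_right, RCLike.conj_to_real]
    have h3 : ⟪y.1, y.2⟫_ℝ = a * ⟪y.1, y.2⟫_ℝ + b * ⟪y.1, y.2⟫_ℝ := by rw [← add_mul, hab, one_mul]
    linarith
  have hbd : ∀ p ∈ S, 0 ≤ p.2 + ‖p.1‖ ^ 2 / 2 := by
    intro p hp
    have h1 := hfitz p hp
    have h2 : 0 ≤ ‖p.1.fst + p.1.snd‖ ^ 2 := by positivity
    rw [norm_add_sq_real] at h2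
    rw [WithLp.prod_norm_sq_eq_of_L2]
    linarith
  obtain ⟨p, hpS, hp⟩ := exists_variational_minimizer hne hcl hconv hbd
  set a := p.1.fst
  set a' := p.1.snd
  have key : ∀ y ∈ Θ, ‖a + a'‖ ^ 2 ≤ ⟪y.2 + a, y.1 + a'⟫_ℝ := by
    intro y hy
    have h1 := hp _ (hmemS y hy)
    have h2 := hfitz p hpS
    simp only [WithLp.prod_inner_apply, inner_sub_right] at h1
    change 0 ≤ ⟪y.1, y.2⟫_ℝ - p.2 + (⟪a, y.1⟫_ℝ + ⟪a', y.2⟫_ℝ - (⟪a, a⟫_ℝ + ⟪a', a'⟫_ℝ)) at h1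
    rw [real_inner_self_eq_norm_sq, real_inner_self_eq_norm_sq] at h1
    rw [norm_add_sq_real]
    simp only [inner_add_left, inner_add_right]
    linarith [real_inner_comm y.1 y.2, real_inner_comm a' y.2]
  have hmem : (-a', -a) ∈ Θ := hΘ.mem_of_forall fun q hq => by
    have h1 := key q hq
    have h2 : ⟪-a - q.2, -a' - q.1⟫_ℝ = ⟪q.2 + a, q.1 + a'⟫_ℝ := by
      rw [← inner_neg_neg]; congr 1 <;> abel
    rw [h2]
    exact (sq_nonneg _).trans h1
  have h0 := key _ hmem
  simp only [neg_add_cancel, inner_zero_left] at h0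
  have h1 : a + a' = 0 := by
    simpa using le_antisymm h0 (sq_nonneg _)
  refine ⟨a, ?_⟩
  rwa [← eq_neg_of_add_eq_zero_left h1, neg_eq_of_add_eq_zero_right h1,
    eq_neg_of_add_eq_zero_right h1] at hmem

/-- **Minty's theorem**: if `Θ` is maximal monotone then `1 + r Θ` is surjective. -/
lemma MaximalMonotoneRelOfType.exists_resolvent {Θ : Set (h × h)}
    (hΘ : MaximalMonotoneRelOfType 0 Θ) {r : ℝ} (hr : 0 < r) (z : h) :
    ∃ x, (x, r⁻¹ • (z - x)) ∈ Θ := by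
  obtain ⟨x, hx⟩ := (hΘ.preimage_affine (inv_pos.2 hr) (r⁻¹ • z)).exists_neg_mem
  refine ⟨x, ?_⟩
  have h1 : r⁻¹ • (z - x) = r⁻¹ • -x + r⁻¹ • z := by rw [← smul_add]; congr 1; abel
  rw [h1]
  exact hx

/-- The sum of a maximal monotone relation and a bounded coercive operator is surjective. -/
lemma MaximalMonotoneRelOfType.exists_add_coercive {Θ : Set (h × h)}
    (hΘ : MaximalMonotoneRelOfType 0 Θ) (B : h →L[ℝ] h) {c : ℝ} (hc : 0 < c)
    (hB : ∀ x, c * ‖x‖ ^ 2 ≤ ⟪B x, x⟫_ℝ) (z : h) : ∃ x, (x, z - B x) ∈ Θ := by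
  set L := ‖B‖ ^ 2 + c ^ 2 with hL
  have hL0 : 0 < L := by positivity
  set r := c / L with hr
  have hr0 : 0 < r := div_pos hc hL0
  choose J hJ using fun w => hΘ.exists_resolvent hr0 w
  have hJne : ∀ v w, ‖J v - J w‖ ≤ ‖v - w‖ := by
    intro v w
    have h1 := hΘ.1 _ (hJ v) _ (hJ w)
    simp only [neg_zero, zero_mul, ← smul_sub, inner_smul_left] at h1
    have h2 := nonneg_of_mul_nonneg_right h1 (inv_pos.2 hr0)
    have h3 : v - J v - (w - J w) = (v - w) - (J v - J w) := by abel
    rw [h3, inner_sub_left, real_inner_self_eq_norm_sq] at h2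
    have h4 := real_inner_le_norm (v - w) (J v - J w)
    by_contra! h5
    nlinarith [norm_nonneg (v - w)]
  set k := √(1 - r * c) with hk
  have hrL : r * L = c := div_mul_cancel₀ c hL0.ne'
  have hrc : r * c ≤ 1 := by
    rw [hr, div_mul_eq_mul_div, div_le_one hL0]
    nlinarith [sq_nonneg ‖B‖]
  have hcontr : ∀ x, ‖x - r • B x‖ ≤ k * ‖x‖ := by
    intro x
    rw [← Real.sqrt_sq (norm_nonneg x), hk, ← Real.sqrt_mul (by linarith)]
    apply Real.le_sqrt_of_sq_le
    rw [norm_sub_sq_real, norm_smul, inner_smul_right, mul_pow, Real.norm_eq_abs, sq_abs,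
      real_inner_comm]
    have h1 := hB x
    have h2 : ‖B x‖ ^ 2 ≤ L * ‖x‖ ^ 2 := by
      have := pow_le_pow_left₀ (norm_nonneg _) (B.le_opNorm x) 2
      rw [mul_pow] at this
      nlinarith [mul_nonneg (sq_nonneg c) (sq_nonneg ‖x‖)]
    have h3 : r ^ 2 * ‖B x‖ ^ 2 ≤ r * c * ‖x‖ ^ 2 := by
      calc r ^ 2 * ‖B x‖ ^ 2 ≤ r ^ 2 * (L * ‖x‖ ^ 2) := by gcongr
        _ = r * (r * L) * ‖x‖ ^ 2 := by ring
        _ = r * c * ‖x‖ ^ 2 := by rw [hrL]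
    nlinarith [mul_le_mul_of_nonneg_left h1 hr0.le]
  have hk1 : k < 1 := by
    rw [hk, Real.sqrt_lt' one_pos]
    nlinarith [mul_pos hr0 hc]
  have hcw : ContractingWith ⟨k, Real.sqrt_nonneg _⟩ fun x => J (x - r • (B x - z)) := by
    refine ⟨hk1, LipschitzWith.of_dist_le_mul fun x y => ?_⟩
    rw [dist_eq_norm, dist_eq_norm]
    refine (hJne _ _).trans ((le_of_eq ?_).trans (hcontr (x - y)))
    congr 1
    rw [map_sub]
    module
  refine ⟨hcw.fixedPoint, ?_⟩
  set x := hcw.fixedPoint with hx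
  have hfix : J (x - r • (B x - z)) = x := hcw.fixedPoint_isFixedPt
  have h1 := hJ (x - r • (B x - z))
  rw [hfix] at h1
  have h2 : r⁻¹ • (x - r • (B x - z) - x) = z - B x := by
    rw [sub_sub_cancel_left, ← smul_neg, smul_smul, inv_mul_cancel₀ hr0.ne', one_smul, neg_sub]
  rwa [h2] at h1

end Minty

/-- The adjoint of a surjective continuous linear map between Hilbert spaces is bounded below. -/
lemma exists_le_norm_adjoint_of_surjective {H h : Type*} [NormedAddCommGroup H]
    [InnerProductSpace ℝ H] [CompleteSpace H] [NormedAddCommGroup h] [InnerProductSpace ℝ h]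
    [CompleteSpace h] (T : H →L[ℝ] h) (hT : Function.Surjective T) :
    ∃ c : ℝ, 0 < c ∧ ∀ x, c * ‖x‖ ^ 2 ≤ ‖ContinuousLinearMap.adjoint T x‖ ^ 2 := by
  obtain ⟨C, hC, hpre⟩ := T.exists_preimage_norm_le hT
  refine ⟨(C ^ 2)⁻¹, by positivity, fun x => ?_⟩
  rw [inv_mul_le_iff₀ (by positivity), ← mul_pow]
  refine pow_le_pow_left₀ (norm_nonneg _) ?_ 2
  obtain ⟨w, rfl, hw⟩ := hpre x
  have h1 := real_inner_le_norm (ContinuousLinearMap.adjoint T (T w)) w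
  rw [ContinuousLinearMap.adjoint_inner_left, real_inner_self_eq_norm_sq] at h1
  by_contra! h2
  have h3 : 0 < ‖T w‖ := lt_of_le_of_lt (by positivity) h2
  nlinarith [mul_le_mul_of_nonneg_left hw (norm_nonneg (ContinuousLinearMap.adjoint T (T w)))]

theorem statement9
    {H : Type*} [NormedAddCommGroup H] [InnerProductSpace ℝ H] [CompleteSpace H]
    {h : Type*} [NormedAddCommGroup h] [InnerProductSpace ℝ h] [CompleteSpace h]
    (ω : ℝ) (D : Submodule ℝ H) (hDdense : Dense (D : Set H))
    (A : D →ₗ[ℝ] H)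
    (hAsym : ∀ u v : D, ⟪A u, (v : H)⟫_ℝ = ⟪(u : H), A v⟫_ℝ)
    (hAbound : ∀ u : D, -ω * ‖(u : H)‖ ^ 2 ≤ ⟪A u, (u : H)⟫_ℝ)
    (R : ℝ → H →L[ℝ] H)
    (hRmem : ∀ lam, ω < lam → ∀ w : H, R lam w ∈ D)
    (hRleft : ∀ lam, ω < lam → ∀ u : D, R lam (A u + lam • (u : H)) = (u : H))
    (hRright : ∀ lam, ∀ hlam : ω < lam, ∀ w : H,
      A ⟨R lam w, hRmem lam hlam w⟩ + lam • R lam w = w)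
    (τ : D →ₗ[ℝ] h) (hτsurj : Function.Surjective τ)
    (hτcont : ∃ C : ℝ, ∀ u : D, ‖τ u‖ ≤ C * (‖A u‖ + ‖(u : H)‖))
    (hτker : Dense (((LinearMap.ker τ).map D.subtype : Submodule ℝ H) : Set H))
    (T : ℝ → H →L[ℝ] h)
    (hT : ∀ lam, ∀ hlam : ω < lam, ∀ w : H, T lam w = τ ⟨R lam w, hRmem lam hlam w⟩)
    (G : ℝ → h →L[ℝ] H)
    (hG : ∀ lam, G lam = ContinuousLinearMap.adjoint (T lam))
    (lam0 : ℝ) (hlam0 : ω < lam0)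
    (Θ : Set (h × h)) (hΘ : MaximalMonotoneRelOfType 0 Θ) :
    (∀ lam, lam0 < lam →
      (∃ ω0 : ℝ, 0 < ω0 ∧ MaximalMonotoneRelOfType (-ω0) (MTheta G lam0 lam Θ)) ∧
      (∀ ζ : h, ∃! ξ : h, (ξ, ζ) ∈ MTheta G lam0 lam Θ) ∧
      (∀ p ∈ MTheta G lam0 lam Θ, ∀ q ∈ MTheta G lam0 lam Θ,
        0 ≤ ⟪p.1 - q.1, p.2 - q.2⟫_ℝ)) ∧
    (∀ lam mu, lam0 < lam → lam0 < mu → ∀ ξ ξ' : h,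
      (ξ, ξ') ∈ MTheta G lam0 mu Θ ↔
        (ξ, ξ' + (lam - mu) • (ContinuousLinearMap.adjoint (G mu)) (G lam ξ)) ∈
          MTheta G lam0 lam Θ) := by
  have hRsymm : ∀ lam, ω < lam → ∀ v w, ⟪R lam v, w⟫_ℝ = ⟪v, R lam w⟫_ℝ := by
    intro lam hlam v w
    have h1 := hAsym ⟨_, hRmem lam hlam v⟩ ⟨_, hRmem lam hlam w⟩
    conv_lhs => rw [← hRright lam hlam w]
    conv_rhs => rw [← hRright lam hlam v]
    rw [inner_add_left, inner_add_right, inner_smul_left, inner_smul_right, h1]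
    rfl
  have hRle : ∀ lam, ω < lam → ∀ w, (lam - ω) * ⟪R lam w, w⟫_ℝ ≤ ‖w‖ ^ 2 := by
    intro lam hlam w
    have h1 := hAbound ⟨_, hRmem lam hlam w⟩
    have h2 : (lam - ω) * ‖R lam w‖ ^ 2 ≤ ⟪R lam w, w⟫_ℝ := by
      have h4 := congrArg (fun v => ⟪v, R lam w⟫_ℝ) (hRright lam hlam w)
      simp only [inner_add_left, inner_smul_left, real_inner_self_eq_norm_sq,
        RCLike.conj_to_real] at h1 h4
      rw [real_inner_comm]
      linarith
    have h3 : 0 ≤ ‖w - (lam - ω) • R lam w‖ ^ 2 := sq_nonneg _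
    rw [norm_sub_sq_real, norm_smul, inner_smul_right, mul_pow, Real.norm_eq_abs, sq_abs,
      real_inner_comm] at h3
    nlinarith [mul_le_mul_of_nonneg_left h2 (sub_pos.2 hlam).le]
  have hTres : ∀ lam mu, ω < lam → ω < mu → ∀ w,
      T mu w = T lam (w + (lam - mu) • R mu w) := by
    intro lam mu hlam hmu w
    rw [hT mu hmu, hT lam hlam]
    congr 1
    apply Subtype.ext
    have h1 := hRleft lam hlam ⟨_, hRmem mu hmu w⟩
    have h2 := hRright mu hmu w
    have h3 : w + (lam - mu) • R mu w
        = A ⟨_, hRmem mu hmu w⟩ + lam • R mu w := by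
      nth_rewrite 1 [← h2]
      module
    rw [h3]
    exact h1.symm
  have hGadj : ∀ lam, ContinuousLinearMap.adjoint (G lam) = T lam := fun lam => by
    rw [hG, ContinuousLinearMap.adjoint_adjoint]
  have hGres : ∀ lam mu, ω < lam → ω < mu → ∀ ξ,
      G mu ξ = G lam ξ + (lam - mu) • R mu (G lam ξ) := by
    intro lam mu hlam hmu ξ
    refine ext_inner_right ℝ fun w => ?_
    rw [inner_add_left, inner_smul_left, hRsymm mu hmu, hG, hG,
      ContinuousLinearMap.adjoint_inner_left, ContinuousLinearMap.adjoint_inner_left,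
      ContinuousLinearMap.adjoint_inner_left, hTres lam mu hlam hmu, map_add, map_smul,
      inner_add_right, inner_smul_right]
    rfl
  refine ⟨fun lam hlam => ?_, fun lam mu hlam hmu ξ ξ' => ?_⟩
  · have hlamω : ω < lam := hlam0.trans hlam
    have hTsurj : Function.Surjective (T lam0) := fun x => by
      obtain ⟨u, rfl⟩ := hτsurj x
      refine ⟨A u + lam0 • (u : H), ?_⟩
      rw [hT lam0 hlam0]
      congr 1
      exact Subtype.ext (hRleft lam0 hlam0 u)
    obtain ⟨c, hc, hcT⟩ := exists_le_norm_adjoint_of_surjective (T lam0) hTsurj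
    set B : h →L[ℝ] h := (lam - lam0) • (ContinuousLinearMap.adjoint (G lam0)).comp (G lam)
    have hBapp : ∀ ξ, (lam - lam0) • (ContinuousLinearMap.adjoint (G lam0)) (G lam ξ) = B ξ :=
      fun ξ => rfl
    set ω0 := (lam - lam0) * ((lam0 - ω) / (lam - ω)) * c with hω0
    have hd : 0 < lam - lam0 := sub_pos.2 hlam
    have hd0 : 0 < lam0 - ω := sub_pos.2 hlam0
    have hdω : 0 < lam - ω := sub_pos.2 hlamω
    have hω0pos : 0 < ω0 := by positivity
    have hB : ∀ ξ, ω0 * ‖ξ‖ ^ 2 ≤ ⟪B ξ, ξ⟫_ℝ := by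
      intro ξ
      have h1 := hcT ξ
      rw [← hG] at h1
      have h2 := hRle lam hlamω (G lam0 ξ)
      have h3 : ⟪B ξ, ξ⟫_ℝ = (lam - lam0) *
          (‖G lam0 ξ‖ ^ 2 - (lam - lam0) * ⟪R lam (G lam0 ξ), G lam0 ξ⟫_ℝ) := by
        rw [← hBapp, inner_smul_left, ContinuousLinearMap.adjoint_inner_left,
          hGres lam0 lam hlam0 hlamω, inner_add_left, inner_smul_left,
          real_inner_self_eq_norm_sq]
        simp only [RCLike.conj_to_real]
        ring
      have h4 : ⟪R lam (G lam0 ξ), G lam0 ξ⟫_ℝ ≤ ‖G lam0 ξ‖ ^ 2 / (lam - ω) := by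
        rw [le_div_iff₀ hdω]; linarith
      rw [h3]
      calc ω0 * ‖ξ‖ ^ 2 = (lam - lam0) * ((lam0 - ω) / (lam - ω)) * (c * ‖ξ‖ ^ 2) := by
            rw [hω0]; ring
        _ ≤ (lam - lam0) * ((lam0 - ω) / (lam - ω)) * ‖G lam0 ξ‖ ^ 2 := by gcongr
        _ = (lam - lam0) *
            (‖G lam0 ξ‖ ^ 2 - (lam - lam0) * (‖G lam0 ξ‖ ^ 2 / (lam - ω))) := by
            field_simp; ring
        _ ≤ _ := by gcongr
    have hmono : MonotoneRelOfType (-ω0) (MTheta G lam0 lam Θ) := by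
      rintro _ ⟨p, hp, rfl⟩ _ ⟨q, hq, rfl⟩
      have h1 := hΘ.1 p hp q hq
      have h2 := hB (p.1 - q.1)
      simp only [hBapp, neg_neg]
      rw [add_sub_add_comm, inner_add_left, ← map_sub]
      linarith
    have hsurj : ∀ ζ, ∃ ξ, (ξ, ζ) ∈ MTheta G lam0 lam Θ := by
      intro ζ
      obtain ⟨ξ, hξ⟩ := hΘ.exists_add_coercive B hω0pos hB ζ
      exact ⟨ξ, _, hξ, by simp only [hBapp, sub_add_cancel]⟩
    have hinj : ∀ Θ' : Set (h × h), MonotoneRelOfType (-ω0) Θ' → ∀ ξ η ζ : h,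
        (ξ, ζ) ∈ Θ' → (η, ζ) ∈ Θ' → ξ = η := by
      intro Θ' hΘ' ξ η ζ hξ hη
      have h1 := hΘ' _ hξ _ hη
      simp only [neg_neg, sub_self, inner_zero_left] at h1
      have h2 : ‖ξ - η‖ ^ 2 = 0 :=
        le_antisymm (nonpos_of_mul_nonpos_right h1 hω0pos) (sq_nonneg _)
      exact sub_eq_zero.1 (by simpa using h2)
    refine ⟨⟨ω0, hω0pos, hmono, fun Θ' hΘ' hsub => ?_⟩, fun ζ => ?_, fun p hp q hq => ?_⟩
    · refine Set.Subset.antisymm (fun p hp => ?_) hsub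
      obtain ⟨ξ, hξ⟩ := hsurj p.2
      have h1 : ξ = p.1 := hinj Θ' hΘ' _ _ _ (hsub hξ) hp
      rwa [h1] at hξ
    · obtain ⟨ξ, hξ⟩ := hsurj ζ
      exact ⟨ξ, hξ, fun η hη => hinj _ hmono _ _ _ hη hξ⟩
    · have h1 := hmono p hp q hq
      rw [real_inner_comm, neg_neg] at h1
      exact (by positivity : 0 ≤ ω0 * ‖p.1 - q.1‖ ^ 2).trans h1
  · have hmem : ∀ nu ζ, (ξ, ζ) ∈ MTheta G lam0 nu Θ ↔
        (ξ, ζ - (nu - lam0) • T lam0 (G nu ξ)) ∈ Θ := by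
      intro nu ζ
      rw [← hGadj]
      constructor
      · rintro ⟨p, hp, heq⟩
        obtain ⟨rfl, rfl⟩ := Prod.ext_iff.1 heq
        simpa using hp
      · intro hp
        exact ⟨_, hp, by simp⟩
    have hlamω := hlam0.trans hlam
    have hmuω := hlam0.trans hmu
    rw [hmem, hmem, hGadj]
    suffices hid : ξ' - (mu - lam0) • T lam0 (G mu ξ)
        = ξ' + (lam - mu) • T mu (G lam ξ) - (lam - lam0) • T lam0 (G lam ξ) by rw [hid]
    rw [hTres lam0 mu hlam0 hmuω, hGres lam mu hlamω hmuω, map_add, map_add, map_smul, map_smul]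
    module
end

section
/- In the standard setting, fix λ∘ > ω, write G∘ := G_{λ∘}, and let Θ ⊆ h × h be a maximal monotone relation. Define D(A_Θ) := {u ∈ H : u = u∘ + G∘ξ for some u∘ ∈ D, ξ ∈ h with (ξ, τu∘) ∈ Θ} and, for u = u∘ + G∘ξ ∈ D(A_Θ), A_Θ(u) := A∘u∘ − λ∘G∘ξ (well defined because the decomposition u = u∘ + G∘ξ with u∘ ∈ D is unique). For λ > λ∘ define R^Θ_λ : H → H by R^Θ_λ(w) := R∘_λw + G_λ((M^Θ_λ)⁻¹(G_λ*w)), where M^Θ_λ := {(ξ, ξ' + (λ − λ∘)G∘*(G_λξ)) : (ξ, ξ') ∈ Θ}. Then for every λ > λ∘: R^Θ_λ is a bijection from H onto D(A_Θ); for every u ∈ D(A_Θ) one has R^Θ_λ(A_Θ(u) + λu) = u, i.e. (R^Θ_λ)⁻¹(u) = A_Θ(u) + λu; and A_Θ is monotone of type λ∘, i.e. ⟨A_Θ(u) − A_Θ(v), u − v⟩ ≥ −λ∘‖u − v‖² for all u, v ∈ D(A_Θ). -/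
local notation "⟪" x ", " y "⟫_ℝ" => @inner ℝ _ _ x y

/-- The resolvent of a symmetric operator is symmetric. -/
theorem inner_resolvent_left {H : Type*} [NormedAddCommGroup H] [InnerProductSpace ℝ H]
    {D : Submodule ℝ H} {A : D →ₗ[ℝ] H}
    (hAsym : ∀ u v : D, ⟪A u, (v : H)⟫_ℝ = ⟪(u : H), A v⟫_ℝ)
    {lam : ℝ} {R : H →L[ℝ] H} (hRmem : ∀ w, R w ∈ D)
    (hRright : ∀ w, A ⟨R w, hRmem w⟩ + lam • R w = w) (x y : H) :
    ⟪R x, y⟫_ℝ = ⟪x, R y⟫_ℝ := by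
  have h := hAsym ⟨R x, hRmem x⟩ ⟨R y, hRmem y⟩
  conv_lhs => rw [← hRright y]
  conv_rhs => rw [← hRright x]
  simp only [inner_add_left, inner_add_right, inner_smul_left, inner_smul_right, h]
  simp

/-- The first resolvent identity. -/
theorem resolvent_eq_resolvent_sub {H : Type*} [NormedAddCommGroup H] [InnerProductSpace ℝ H]
    {D : Submodule ℝ H} {A : D →ₗ[ℝ] H} {lam lam0 : ℝ} {R R0 : H →L[ℝ] H}
    (hRmem : ∀ w, R w ∈ D) (hRright : ∀ w, A ⟨R w, hRmem w⟩ + lam • R w = w)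
    (hR0left : ∀ u : D, R0 (A u + lam0 • (u : H)) = (u : H)) (w : H) :
    R w = R0 (w - (lam - lam0) • R w) := by
  have h := hR0left ⟨R w, hRmem w⟩
  refine h.symm.trans ?_
  congr 1
  rw [eq_sub_iff_add_eq]
  conv_rhs => rw [← hRright w]
  module

theorem statement10
    {H : Type*} [NormedAddCommGroup H] [InnerProductSpace ℝ H] [CompleteSpace H]
    {h : Type*} [NormedAddCommGroup h] [InnerProductSpace ℝ h] [CompleteSpace h]
    (ω : ℝ) (D : Submodule ℝ H) (hDdense : Dense (D : Set H))
    (A : D →ₗ[ℝ] H)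
    (hAsym : ∀ u v : D, ⟪A u, (v : H)⟫_ℝ = ⟪(u : H), A v⟫_ℝ)
    (hAbound : ∀ u : D, -ω * ‖(u : H)‖ ^ 2 ≤ ⟪A u, (u : H)⟫_ℝ)
    (R : ℝ → H →L[ℝ] H)
    (hRmem : ∀ lam, ω < lam → ∀ w : H, R lam w ∈ D)
    (hRleft : ∀ lam, ω < lam → ∀ u : D, R lam (A u + lam • (u : H)) = (u : H))
    (hRright : ∀ lam, ∀ hlam : ω < lam, ∀ w : H,
      A ⟨R lam w, hRmem lam hlam w⟩ + lam • R lam w = w)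
    (τ : D →ₗ[ℝ] h) (hτsurj : Function.Surjective τ)
    (hτcont : ∃ C : ℝ, ∀ u : D, ‖τ u‖ ≤ C * (‖A u‖ + ‖(u : H)‖))
    (hτker : Dense (((LinearMap.ker τ).map D.subtype : Submodule ℝ H) : Set H))
    (T : ℝ → H →L[ℝ] h)
    (hT : ∀ lam, ∀ hlam : ω < lam, ∀ w : H, T lam w = τ ⟨R lam w, hRmem lam hlam w⟩)
    (G : ℝ → h →L[ℝ] H)
    (hG : ∀ lam, G lam = ContinuousLinearMap.adjoint (T lam))
    (lam0 : ℝ) (hlam0 : ω < lam0)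
    (Θ : Set (h × h)) (hΘ : MaximalMonotoneRelOfType 0 Θ)
    (V : ℝ → h → h)
    (hV : ∀ lam, lam0 < lam → ∀ ζ : h, (V lam ζ, ζ) ∈ MTheta G lam0 lam Θ)
    (hVuniq : ∀ lam, lam0 < lam → ∀ ξ ζ : h,
      (ξ, ζ) ∈ MTheta G lam0 lam Θ → ξ = V lam ζ) :
    (∀ lam, lam0 < lam →
      Set.BijOn
        (fun w : H =>
          R lam w + G lam (V lam ((ContinuousLinearMap.adjoint (G lam)) w)))
        Set.univ
        {w : H | ∃ (u0 : D) (ξ : h), w = (u0 : H) + G lam0 ξ ∧ (ξ, τ u0) ∈ Θ} ∧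
      ∀ (u0 : D) (ξ : h), (ξ, τ u0) ∈ Θ →
        R lam ((A u0 - lam0 • G lam0 ξ) + lam • ((u0 : H) + G lam0 ξ)) +
            G lam (V lam ((ContinuousLinearMap.adjoint (G lam))
              ((A u0 - lam0 • G lam0 ξ) + lam • ((u0 : H) + G lam0 ξ)))) =
          (u0 : H) + G lam0 ξ) ∧
    (∀ (u0 v0 : D) (ξ ζ : h), (ξ, τ u0) ∈ Θ → (ζ, τ v0) ∈ Θ →
      -lam0 * ‖((u0 : H) + G lam0 ξ) - ((v0 : H) + G lam0 ζ)‖ ^ 2 ≤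
        ⟪(A u0 - lam0 • G lam0 ξ) - (A v0 - lam0 • G lam0 ζ),
          ((u0 : H) + G lam0 ξ) - ((v0 : H) + G lam0 ζ)⟫_ℝ) := by
  have hGT : ∀ lam x ξ, ⟪G lam ξ, x⟫_ℝ = ⟪ξ, T lam x⟫_ℝ := fun lam x ξ => by
    rw [hG, ContinuousLinearMap.adjoint_inner_left]
  have hGadj : ∀ lam, ContinuousLinearMap.adjoint (G lam) = T lam := fun lam => by
    rw [hG, ContinuousLinearMap.adjoint_adjoint]
  have hTA : ∀ lam, ω < lam → ∀ u : D, T lam (A u + lam • (u : H)) = τ u := fun lam hlam u => by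
    rw [hT lam hlam]
    exact congrArg τ (Subtype.ext (hRleft lam hlam u))
  have hT_eq : ∀ lam, ω < lam → ∀ w,
      T lam w = T lam0 w - (lam - lam0) • T lam0 (R lam w) := fun lam hlam w => by
    rw [← map_smul, ← map_sub, hT lam hlam, hT lam0 hlam0]
    exact congrArg τ (Subtype.ext (resolvent_eq_resolvent_sub (hRmem lam hlam)
      (hRright lam hlam) (hRleft lam0 hlam0) w))
  have hG_eq : ∀ lam, ω < lam → ∀ ξ,
      G lam ξ = G lam0 ξ - (lam - lam0) • R lam (G lam0 ξ) := fun lam hlam ξ => by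
    refine ext_inner_right ℝ fun x => ?_
    rw [inner_sub_left, real_inner_smul_left,
      inner_resolvent_left hAsym (hRmem lam hlam) (hRright lam hlam), hGT, hGT, hGT,
      hT_eq lam hlam, inner_sub_right, real_inner_smul_right]
  have hTG : ∀ lam, ω < lam → ∀ ξ, T lam0 (G lam ξ) = T lam (G lam0 ξ) := fun lam hlam ξ => by
    rw [hG_eq lam hlam, hT_eq lam hlam, map_sub, map_smul]
  have hGD : ∀ (d : D) (η : h), (d : H) = G lam0 η → (d : H) = 0 := fun d η hd => by
    have hzero : A d + lam0 • (d : H) = 0 := by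
      refine hτker.eq_zero_of_inner_left ℝ ?_
      rintro _ ⟨z, hz, rfl⟩
      have hz' : τ z = 0 := hz
      calc ⟪A d + lam0 • (d : H), (z : H)⟫_ℝ
          = ⟪(d : H), A z + lam0 • (z : H)⟫_ℝ := by
            rw [inner_add_left, inner_add_right, hAsym, real_inner_smul_left,
              real_inner_smul_right]
        _ = 0 := by rw [hd, hGT, hTA lam0 hlam0, hz', inner_zero_right]
    rw [← hRleft lam0 hlam0 d, hzero, map_zero]
  have hleft : ∀ lam, lam0 < lam → ∀ (u0 : D) (ξ : h), (ξ, τ u0) ∈ Θ →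
      R lam ((A u0 - lam0 • G lam0 ξ) + lam • ((u0 : H) + G lam0 ξ)) +
          G lam (V lam ((ContinuousLinearMap.adjoint (G lam))
            ((A u0 - lam0 • G lam0 ξ) + lam • ((u0 : H) + G lam0 ξ)))) =
        (u0 : H) + G lam0 ξ := fun lam hlam u0 ξ hξ => by
    have hω := hlam0.trans hlam
    have hw : (A u0 - lam0 • G lam0 ξ) + lam • ((u0 : H) + G lam0 ξ) =
        (A u0 + lam • (u0 : H)) + (lam - lam0) • G lam0 ξ := by module
    have hM : (ξ, T lam ((A u0 + lam • (u0 : H)) + (lam - lam0) • G lam0 ξ)) ∈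
        MTheta G lam0 lam Θ := by
      refine ⟨_, hξ, ?_⟩
      simp only [hGadj, hTG lam hω, map_add, map_smul, hTA lam hω]
    rw [hw, hGadj, ← hVuniq lam hlam _ _ hM, hG_eq lam hω, map_add, hRleft lam hω, map_smul]
    abel
  have hrepr : ∀ lam, lam0 < lam → ∀ w : H, ∃ (u0 : D) (ξ : h), (ξ, τ u0) ∈ Θ ∧
      w = (A u0 - lam0 • G lam0 ξ) + lam • ((u0 : H) + G lam0 ξ) := fun lam hlam w => by
    have hω := hlam0.trans hlam
    obtain ⟨⟨ξ, ξ'⟩, hξ, hp⟩ := hV lam hlam (T lam w)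
    obtain ⟨-, h2⟩ := Prod.mk.inj hp
    simp only [hGadj, hTG lam hω] at h2
    refine ⟨⟨_, hRmem lam hω (w - (lam - lam0) • G lam0 ξ)⟩, ξ, ?_, ?_⟩
    · rwa [← hT lam hω, map_sub, map_smul, ← h2, add_sub_cancel_right]
    · have h3 := hRright lam hω (w - (lam - lam0) • G lam0 ξ)
      rw [eq_sub_iff_add_eq] at h3
      conv_lhs => rw [← h3]
      module
  refine ⟨fun lam hlam => ⟨⟨?_, ?_, ?_⟩, hleft lam hlam⟩, ?_⟩
  · intro w _
    obtain ⟨u0, ξ, hξ, rfl⟩ := hrepr lam hlam w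
    exact ⟨u0, ξ, hleft lam hlam u0 ξ hξ, hξ⟩
  · intro w _ z _ hwz
    obtain ⟨u0, ξ, hξ, rfl⟩ := hrepr lam hlam w
    obtain ⟨v0, ζ, hζ, rfl⟩ := hrepr lam hlam z
    simp only [hleft lam hlam u0 ξ hξ, hleft lam hlam v0 ζ hζ] at hwz
    have hd := hGD (v0 - u0) (ξ - ζ) (by
      rw [map_sub, Submodule.coe_sub, sub_eq_sub_iff_add_eq_add, add_comm (G lam0 ξ), hwz, add_comm])
    rw [Submodule.coe_sub, sub_eq_zero] at hd
    obtain rfl : v0 = u0 := Subtype.ext hd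
    rw [add_left_cancel hwz]
  · rintro _ ⟨u0, ξ, rfl, hξ⟩
    exact ⟨_, trivial, hleft lam hlam u0 ξ hξ⟩
  · intro u0 v0 ξ ζ hξ hζ
    have hmono : 0 ≤ ⟪τ u0 - τ v0, ξ - ζ⟫_ℝ := by simpa using hΘ.1 _ hξ _ hζ
    rw [← map_sub] at hmono
    have hu : ((u0 : H) + G lam0 ξ) - ((v0 : H) + G lam0 ζ) =
        ((u0 - v0 : D) : H) + G lam0 (ξ - ζ) := by
      rw [map_sub, Submodule.coe_sub]; abel
    have hAu : (A u0 - lam0 • G lam0 ξ) - (A v0 - lam0 • G lam0 ζ) =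
        (A (u0 - v0) + lam0 • ((u0 - v0 : D) : H)) -
          lam0 • (((u0 - v0 : D) : H) + G lam0 (ξ - ζ)) := by
      simp only [map_sub]; module
    rw [hu, hAu, inner_sub_left, real_inner_smul_left, real_inner_self_eq_norm_sq,
      inner_add_right, real_inner_comm (G lam0 (ξ - ζ)), hGT, hTA lam0 hlam0, inner_add_left,
      real_inner_smul_left, real_inner_self_eq_norm_sq, real_inner_comm (τ (u0 - v0))]
    nlinarith [hAbound (u0 - v0),
      mul_nonneg (sub_pos.2 hlam0).le (sq_nonneg ‖((u0 - v0 : D) : H)‖)]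
end

section
/- In the standard setting, let λ, μ > ω, u_λ, u_μ ∈ D and ξ, ζ ∈ h. If u_λ + G_λξ = u_μ + G_μζ, then ξ = ζ and u_λ = u_μ + (G_μ − G_λ)ξ. In particular, for any fixed λ∘ > ω, every u ∈ H admits at most one decomposition u = u∘ + G_{λ∘}ξ with u∘ ∈ D and ξ ∈ h. -/
local notation "⟪" x ", " y "⟫_ℝ" => @inner ℝ _ _ x y

/-- The adjoint `S` of `τ` composed with the resolvent of `A` at `lam` satisfies a Green-type
identity against elements of the domain of `A`. -/
lemma inner_adjoint_trace_resolvent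
    {H : Type*} [NormedAddCommGroup H] [InnerProductSpace ℝ H] [CompleteSpace H]
    {h : Type*} [NormedAddCommGroup h] [InnerProductSpace ℝ h] [CompleteSpace h]
    {D : Submodule ℝ H} {A : D →ₗ[ℝ] H} {τ : D →ₗ[ℝ] h} {lam : ℝ}
    {R : H →L[ℝ] H} (hRmem : ∀ w, R w ∈ D)
    (hRleft : ∀ u : D, R (A u + lam • (u : H)) = (u : H))
    {T : H →L[ℝ] h} (hT : ∀ w, T w = τ ⟨R w, hRmem w⟩) (ξ : h) (v : D) :
    inner ℝ (ContinuousLinearMap.adjoint T ξ) (A v) =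
      inner ℝ ξ (τ v) - lam * inner ℝ (ContinuousLinearMap.adjoint T ξ) (v : H) := by
  have hTv : T (A v + lam • (v : H)) = τ v := by
    rw [hT]
    congr 1
    exact Subtype.ext (hRleft v)
  have key := ContinuousLinearMap.adjoint_inner_left T (A v + lam • (v : H)) ξ
  rw [hTv, inner_add_right, real_inner_smul_right] at key
  linarith

/-- A surjective linear map with dense kernel admits only the trivial weak adjoint pair. -/
lemma eq_zero_of_inner_eq_inner_of_dense_ker
    {H : Type*} [NormedAddCommGroup H] [InnerProductSpace ℝ H]
    {h : Type*} [NormedAddCommGroup h] [InnerProductSpace ℝ h]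
    {D : Submodule ℝ H} {τ : D →ₗ[ℝ] h} (hτsurj : Function.Surjective τ)
    (hτker : Dense (((LinearMap.ker τ).map D.subtype : Submodule ℝ H) : Set H))
    {x : H} {η : h} (hx : ∀ v : D, inner ℝ x (v : H) = inner ℝ η (τ v)) : η = 0 := by
  have hx0 : x = 0 := by
    refine hτker.eq_zero_of_inner_left ℝ ?_
    rintro _ ⟨v, hv, rfl⟩
    have hv0 : τ v = 0 := hv
    simpa [hv0] using hx v
  obtain ⟨v, rfl⟩ := hτsurj η
  simpa [hx0] using (hx v).symm

theorem statement11
    {H : Type*} [NormedAddCommGroup H] [InnerProductSpace ℝ H] [CompleteSpace H]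
    {h : Type*} [NormedAddCommGroup h] [InnerProductSpace ℝ h] [CompleteSpace h]
    (ω : ℝ) (D : Submodule ℝ H) (hDdense : Dense (D : Set H))
    (A : D →ₗ[ℝ] H)
    (hAsym : ∀ u v : D, ⟪A u, (v : H)⟫_ℝ = ⟪(u : H), A v⟫_ℝ)
    (hAbound : ∀ u : D, -ω * ‖(u : H)‖ ^ 2 ≤ ⟪A u, (u : H)⟫_ℝ)
    (R : ℝ → H →L[ℝ] H)
    (hRmem : ∀ lam, ω < lam → ∀ w : H, R lam w ∈ D)
    (hRleft : ∀ lam, ω < lam → ∀ u : D, R lam (A u + lam • (u : H)) = (u : H))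
    (hRright : ∀ lam, ∀ hlam : ω < lam, ∀ w : H,
      A ⟨R lam w, hRmem lam hlam w⟩ + lam • R lam w = w)
    (τ : D →ₗ[ℝ] h) (hτsurj : Function.Surjective τ)
    (hτcont : ∃ C : ℝ, ∀ u : D, ‖τ u‖ ≤ C * (‖A u‖ + ‖(u : H)‖))
    (hτker : Dense (((LinearMap.ker τ).map D.subtype : Submodule ℝ H) : Set H))
    (T : ℝ → H →L[ℝ] h)
    (hT : ∀ lam, ∀ hlam : ω < lam, ∀ w : H, T lam w = τ ⟨R lam w, hRmem lam hlam w⟩)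
    (G : ℝ → h →L[ℝ] H)
    (hG : ∀ lam, G lam = ContinuousLinearMap.adjoint (T lam)) :
    (∀ lam mu, ω < lam → ω < mu → ∀ (ulam umu : D) (ξ ζ : h),
      (ulam : H) + G lam ξ = (umu : H) + G mu ζ →
        ξ = ζ ∧ (ulam : H) = (umu : H) + (G mu ξ - G lam ξ)) ∧
    (∀ lam0, ω < lam0 → ∀ (u0 v0 : D) (ξ ζ : h),
      (u0 : H) + G lam0 ξ = (v0 : H) + G lam0 ζ → u0 = v0 ∧ ξ = ζ) := by
  have main : ∀ lam mu, ω < lam → ω < mu → ∀ (ulam umu : D) (ξ ζ : h),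
      (ulam : H) + G lam ξ = (umu : H) + G mu ζ → ξ = ζ := by
    intro lam mu hlam hmu ulam umu ξ ζ he
    refine sub_eq_zero.mp (eq_zero_of_inner_eq_inner_of_dense_ker hτsurj hτker
      (x := A (umu - ulam) + lam • G lam ξ - mu • G mu ζ) fun v => ?_)
    have hlamv := inner_adjoint_trace_resolvent (hRmem lam hlam) (hRleft lam hlam)
      (hT lam hlam) ξ v
    have hmuv := inner_adjoint_trace_resolvent (hRmem mu hmu) (hRleft mu hmu)
      (hT mu hmu) ζ v
    rw [← hG] at hlamv hmuv
    have hdiff : ((umu - ulam : D) : H) = G lam ξ - G mu ζ := by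
      rw [Submodule.coe_sub, sub_eq_sub_iff_add_eq_add, ← he, add_comm]
    have hsymm := hAsym (umu - ulam) v
    rw [hdiff, inner_sub_left] at hsymm
    rw [inner_sub_left, inner_add_left, real_inner_smul_left, real_inner_smul_left,
      inner_sub_left]
    linarith
  refine ⟨fun lam mu hlam hmu ulam umu ξ ζ he => ?_, fun lam0 hlam0 u0 v0 ξ ζ he => ?_⟩
  · obtain rfl := main lam mu hlam hmu ulam umu ξ ζ he
    exact ⟨rfl, by rw [← add_sub_assoc, ← he, add_sub_cancel_right]⟩
  · obtain rfl := main lam0 lam0 hlam0 hlam0 u0 v0 ξ ζ he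
    exact ⟨Subtype.ext (add_right_cancel he), rfl⟩
end

section
/- In the standard setting with λ∘ > ω and G∘ := G_{λ∘}, let φ : h → (−∞, +∞] be a proper convex function and Θ := ∂φ its subdifferential. Let A_Θ be the extension operator with domain D(A_Θ) := {u∘ + G∘ξ : u∘ ∈ D, (ξ, τu∘) ∈ ∂φ} and A_Θ(u∘ + G∘ξ) := A∘u∘ − λ∘G∘ξ. For w = w∘ + G∘ζ with w∘ ∈ D and φ(ζ) < +∞, set Φ(w) := (1/2)⟨A∘w∘ + λ∘w∘, w∘⟩ + φ(ζ). Then for every u = u∘ + G∘ξ ∈ D(A_Θ), every v∘ ∈ D and every ζ ∈ h with φ(ζ) < +∞, writing v := v∘ + G∘ζ, one has ⟨A_Θ(u) + λ∘u, u − v⟩ ≥ Φ(u) − Φ(v). -/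
local notation "⟪" x ", " y "⟫_ℝ" => @inner ℝ _ _ x y

/-- The convexity inequality for the quadratic form of a symmetric operator bounded below. -/
theorem half_quadForm_sub_le {H : Type*} [NormedAddCommGroup H] [InnerProductSpace ℝ H]
    {ω lam : ℝ} {D : Submodule ℝ H} {A : D →ₗ[ℝ] H}
    (hAsym : ∀ u v : D, ⟪A u, (v : H)⟫_ℝ = ⟪(u : H), A v⟫_ℝ)
    (hAbound : ∀ u : D, -ω * ‖(u : H)‖ ^ 2 ≤ ⟪A u, (u : H)⟫_ℝ) (hlam : ω ≤ lam) (u v : D) :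
    (1 / 2 : ℝ) * ⟪A u + lam • (u : H), (u : H)⟫_ℝ -
        (1 / 2 : ℝ) * ⟪A v + lam • (v : H), (v : H)⟫_ℝ ≤
      ⟪A u + lam • (u : H), (u : H) - (v : H)⟫_ℝ := by
  have hb := hAbound (u - v)
  have hn : 0 ≤ (lam - ω) * ‖((u - v : D) : H)‖ ^ 2 :=
    mul_nonneg (sub_nonneg.2 hlam) (sq_nonneg _)
  rw [← real_inner_self_eq_norm_sq] at hb hn
  have hs : ⟪A v, (u : H)⟫_ℝ = ⟪A u, (v : H)⟫_ℝ := by rw [hAsym, real_inner_comm]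
  have hc : ⟪(v : H), (u : H)⟫_ℝ = ⟪(u : H), (v : H)⟫_ℝ := real_inner_comm _ _
  simp only [map_sub, Submodule.coe_sub, inner_sub_left, inner_sub_right, inner_add_left,
    real_inner_smul_left, hs, hc] at hb hn ⊢
  linarith

theorem statement15
    {H : Type*} [NormedAddCommGroup H] [InnerProductSpace ℝ H] [CompleteSpace H]
    {h : Type*} [NormedAddCommGroup h] [InnerProductSpace ℝ h] [CompleteSpace h]
    (ω : ℝ) (D : Submodule ℝ H) (hDdense : Dense (D : Set H))
    (A : D →ₗ[ℝ] H)
    (hAsym : ∀ u v : D, ⟪A u, (v : H)⟫_ℝ = ⟪(u : H), A v⟫_ℝ)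
    (hAbound : ∀ u : D, -ω * ‖(u : H)‖ ^ 2 ≤ ⟪A u, (u : H)⟫_ℝ)
    (R : ℝ → H →L[ℝ] H)
    (hRmem : ∀ lam, ω < lam → ∀ w : H, R lam w ∈ D)
    (hRleft : ∀ lam, ω < lam → ∀ u : D, R lam (A u + lam • (u : H)) = (u : H))
    (hRright : ∀ lam, ∀ hlam : ω < lam, ∀ w : H,
      A ⟨R lam w, hRmem lam hlam w⟩ + lam • R lam w = w)
    (τ : D →ₗ[ℝ] h) (hτsurj : Function.Surjective τ)
    (hτcont : ∃ C : ℝ, ∀ u : D, ‖τ u‖ ≤ C * (‖A u‖ + ‖(u : H)‖))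
    (hτker : Dense (((LinearMap.ker τ).map D.subtype : Submodule ℝ H) : Set H))
    (T : ℝ → H →L[ℝ] h)
    (hT : ∀ lam, ∀ hlam : ω < lam, ∀ w : H, T lam w = τ ⟨R lam w, hRmem lam hlam w⟩)
    (G : ℝ → h →L[ℝ] H)
    (hG : ∀ lam, G lam = ContinuousLinearMap.adjoint (T lam))
    (lam0 : ℝ) (hlam0 : ω < lam0)
    (S : Set h) (φ : h → ℝ) (hSne : S.Nonempty)
    (hconv : ∀ ξ ∈ S, ∀ ζ ∈ S, ∀ t : ℝ, 0 ≤ t → t ≤ 1 →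
      t • ξ + (1 - t) • ζ ∈ S ∧
      φ (t • ξ + (1 - t) • ζ) ≤ t * φ ξ + (1 - t) * φ ζ) :
    ∀ (u0 : D) (ξ : h), ξ ∈ S →
      (∀ ζ ∈ S, φ ξ ≤ φ ζ + ⟪τ u0, ξ - ζ⟫_ℝ) →
      ∀ (v0 : D) (ζ : h), ζ ∈ S →
        ((1 : ℝ) / 2) * ⟪A u0 + lam0 • (u0 : H), (u0 : H)⟫_ℝ + φ ξ -
            (((1 : ℝ) / 2) * ⟪A v0 + lam0 • (v0 : H), (v0 : H)⟫_ℝ + φ ζ) ≤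
          ⟪(A u0 - lam0 • G lam0 ξ) + lam0 • ((u0 : H) + G lam0 ξ),
            ((u0 : H) + G lam0 ξ) - ((v0 : H) + G lam0 ζ)⟫_ℝ := by
  intro u0 ξ _ hsub v0 ζ hζ
  have hTu : T lam0 (A u0 + lam0 • (u0 : H)) = τ u0 := by
    rw [hT lam0 hlam0]
    congr 1
    exact Subtype.ext (hRleft lam0 hlam0 u0)
  have hG' : ⟪A u0 + lam0 • (u0 : H), G lam0 (ξ - ζ)⟫_ℝ = ⟪τ u0, ξ - ζ⟫_ℝ := by
    rw [hG, ContinuousLinearMap.adjoint_inner_right, hTu]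
  have hl : (A u0 - lam0 • G lam0 ξ) + lam0 • ((u0 : H) + G lam0 ξ) =
      A u0 + lam0 • (u0 : H) := by
    rw [smul_add]
    abel
  have hr : ((u0 : H) + G lam0 ξ) - ((v0 : H) + G lam0 ζ) =
      ((u0 : H) - (v0 : H)) + G lam0 (ξ - ζ) := by
    rw [map_sub]
    abel
  rw [hl, hr, inner_add_right, hG']
  linarith [hsub ζ hζ, half_quadForm_sub_le hAsym hAbound hlam0.le u0 v0]
end

section
/- In the standard setting with λ∘ > ω and G∘ := G_{λ∘}, let φ : h → (−∞, +∞] be a proper convex function. For w = w∘ + G∘ζ with w∘ ∈ D and φ(ζ) < +∞, set Φ(w) := (1/2)⟨A∘w∘ + λ∘w∘, w∘⟩ + φ(ζ). Suppose u = u∘ + G∘ξ with u∘ ∈ D and φ(ξ) < +∞, and suppose ũ ∈ H satisfies ⟨ũ, u − (v∘ + G∘ζ)⟩ ≥ Φ(u) − Φ(v∘ + G∘ζ) for every v∘ ∈ D and every ζ ∈ h with φ(ζ) < +∞. Then ũ = A∘u∘ + λ∘u∘ and (ξ, τu∘) ∈ ∂φ; consequently u belongs to D(A_{∂φ}) :=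 {w∘ + G∘ζ : w∘ ∈ D, (ζ, τw∘) ∈ ∂φ} and ũ = A_{∂φ}(u) + λ∘u, where A_{∂φ}(w∘ + G∘ζ) := A∘w∘ − λ∘G∘ζ. -/
local notation "⟪" x ", " y "⟫_ℝ" => @inner ℝ _ _ x y

/-- A linear function dominated by a quadratic one without lower-order terms vanishes. -/
theorem eq_zero_of_forall_mul_le_mul_sq {c q : ℝ} (hcq : ∀ t : ℝ, t * c ≤ t ^ 2 * q) : c = 0 := by
  have hK : 0 < 1 + |q| := by positivity
  have h1 := hcq (c / (1 + |q|))
  have h2 : c ^ 2 * (1 + |q|) ≤ c ^ 2 * q := by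
    have h3 := mul_le_mul_of_nonneg_right h1 (sq_nonneg (1 + |q|))
    field_simp at h3
    exact h3
  have h4 : c ^ 2 * q ≤ c ^ 2 * |q| := mul_le_mul_of_nonneg_left (le_abs_self q) (sq_nonneg c)
  have h5 : c ^ 2 = 0 := le_antisymm (by linarith) (sq_nonneg c)
  exact pow_eq_zero_iff two_ne_zero |>.mp h5

theorem statement16
    {H : Type*} [NormedAddCommGroup H] [InnerProductSpace ℝ H] [CompleteSpace H]
    {h : Type*} [NormedAddCommGroup h] [InnerProductSpace ℝ h] [CompleteSpace h]
    (ω : ℝ) (D : Submodule ℝ H) (hDdense : Dense (D : Set H))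
    (A : D →ₗ[ℝ] H)
    (hAsym : ∀ u v : D, ⟪A u, (v : H)⟫_ℝ = ⟪(u : H), A v⟫_ℝ)
    (hAbound : ∀ u : D, -ω * ‖(u : H)‖ ^ 2 ≤ ⟪A u, (u : H)⟫_ℝ)
    (R : ℝ → H →L[ℝ] H)
    (hRmem : ∀ lam, ω < lam → ∀ w : H, R lam w ∈ D)
    (hRleft : ∀ lam, ω < lam → ∀ u : D, R lam (A u + lam • (u : H)) = (u : H))
    (hRright : ∀ lam, ∀ hlam : ω < lam, ∀ w : H,
      A ⟨R lam w, hRmem lam hlam w⟩ + lam • R lam w = w)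
    (τ : D →ₗ[ℝ] h) (hτsurj : Function.Surjective τ)
    (hτcont : ∃ C : ℝ, ∀ u : D, ‖τ u‖ ≤ C * (‖A u‖ + ‖(u : H)‖))
    (hτker : Dense (((LinearMap.ker τ).map D.subtype : Submodule ℝ H) : Set H))
    (T : ℝ → H →L[ℝ] h)
    (hT : ∀ lam, ∀ hlam : ω < lam, ∀ w : H, T lam w = τ ⟨R lam w, hRmem lam hlam w⟩)
    (G : ℝ → h →L[ℝ] H)
    (hG : ∀ lam, G lam = ContinuousLinearMap.adjoint (T lam))
    (lam0 : ℝ) (hlam0 : ω < lam0)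
    (S : Set h) (φ : h → ℝ) (hSne : S.Nonempty)
    (hconv : ∀ ξ ∈ S, ∀ ζ ∈ S, ∀ t : ℝ, 0 ≤ t → t ≤ 1 →
      t • ξ + (1 - t) • ζ ∈ S ∧
      φ (t • ξ + (1 - t) • ζ) ≤ t * φ ξ + (1 - t) * φ ζ)
    (u0 : D) (ξ : h) (hξ : ξ ∈ S) (utilde : H)
    (hsub : ∀ (v0 : D) (ζ : h), ζ ∈ S →
      ((1 : ℝ) / 2) * ⟪A u0 + lam0 • (u0 : H), (u0 : H)⟫_ℝ + φ ξ -
          (((1 : ℝ) / 2) * ⟪A v0 + lam0 • (v0 : H), (v0 : H)⟫_ℝ + φ ζ) ≤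
        ⟪utilde, ((u0 : H) + G lam0 ξ) - ((v0 : H) + G lam0 ζ)⟫_ℝ) :
    utilde = A u0 + lam0 • (u0 : H) ∧
    (∀ ζ ∈ S, φ ξ ≤ φ ζ + ⟪τ u0, ξ - ζ⟫_ℝ) ∧
    utilde = (A u0 - lam0 • G lam0 ξ) + lam0 • ((u0 : H) + G lam0 ξ) := by
  have key : utilde = A u0 + lam0 • (u0 : H) := by
    refine hDdense.eq_of_inner_left (𝕜 := ℝ) fun z hz => ?_
    let z' : D := ⟨z, hz⟩
    have hz0 : ⟪A u0 + lam0 • (u0 : H), z⟫_ℝ - ⟪utilde, z⟫_ℝ = 0 := by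
      refine eq_zero_of_forall_mul_le_mul_sq (q := (1 / 2) * ⟪A z' + lam0 • z, z⟫_ℝ) fun t => ?_
      have hs := hsub (u0 - t • z') ξ hξ
      have hAz : ⟪A z', (u0 : H)⟫_ℝ = ⟪A u0, z⟫_ℝ := by
        rw [hAsym, real_inner_comm, real_inner_comm]
      have hc : ⟪z, (u0 : H)⟫_ℝ = ⟪(u0 : H), z⟫_ℝ := real_inner_comm _ _
      have hd : ((u0 : H) + G lam0 ξ) - (((u0 - t • z' : D) : H) + G lam0 ξ) = t • z := by
        simp [z']
      rw [hd] at hs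
      simp only [map_sub, map_smul, AddSubgroupClass.coe_sub, SetLike.val_smul, inner_add_left,
        inner_sub_left, inner_sub_right, inner_smul_left, inner_smul_right, smul_sub,
        conj_trivial, hAz, hc, z'] at hs ⊢
      linarith
    linarith
  refine ⟨key, fun ζ hζ => ?_, ?_⟩
  · have hs := hsub u0 ζ hζ
    have hd : ((u0 : H) + G lam0 ξ) - ((u0 : H) + G lam0 ζ) = G lam0 (ξ - ζ) := by
      rw [map_sub]; abel
    have hTu : T lam0 (A u0 + lam0 • (u0 : H)) = τ u0 := by
      rw [hT lam0 hlam0]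
      congr 1
      exact Subtype.ext (hRleft lam0 hlam0 u0)
    rw [hd, hG, ContinuousLinearMap.adjoint_inner_right, key, hTu] at hs
    linarith
  · rw [key, smul_add]
    abel
end

section
/- In the standard setting with λ∘ > ω, G∘ := G_{λ∘}, and Θ ⊆ h × h a maximal monotone relation, let A_Θ be the extension operator with domain D(A_Θ) := {u∘ + G∘ξ : u∘ ∈ D, (ξ, τu∘) ∈ Θ} and A_Θ(u∘ + G∘ξ) := A∘u∘ − λ∘G∘ξ. Then A_Θ is a restriction of the adjoint of S := A∘ restricted to kernel(τ); concretely, for every u ∈ D(A_Θ) and every v ∈ kernel(τ) one has ⟨A_Θ(u), v⟩ = ⟨u, A∘v⟩. -/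
local notation "⟪" x ", " y "⟫_ℝ" => @inner ℝ _ _ x y

theorem statement18
    {H : Type*} [NormedAddCommGroup H] [InnerProductSpace ℝ H] [CompleteSpace H]
    {h : Type*} [NormedAddCommGroup h] [InnerProductSpace ℝ h] [CompleteSpace h]
    (ω : ℝ) (D : Submodule ℝ H) (hDdense : Dense (D : Set H))
    (A : D →ₗ[ℝ] H)
    (hAsym : ∀ u v : D, ⟪A u, (v : H)⟫_ℝ = ⟪(u : H), A v⟫_ℝ)
    (hAbound : ∀ u : D, -ω * ‖(u : H)‖ ^ 2 ≤ ⟪A u, (u : H)⟫_ℝ)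
    (R : ℝ → H →L[ℝ] H)
    (hRmem : ∀ lam, ω < lam → ∀ w : H, R lam w ∈ D)
    (hRleft : ∀ lam, ω < lam → ∀ u : D, R lam (A u + lam • (u : H)) = (u : H))
    (hRright : ∀ lam, ∀ hlam : ω < lam, ∀ w : H,
      A ⟨R lam w, hRmem lam hlam w⟩ + lam • R lam w = w)
    (τ : D →ₗ[ℝ] h) (hτsurj : Function.Surjective τ)
    (hτcont : ∃ C : ℝ, ∀ u : D, ‖τ u‖ ≤ C * (‖A u‖ + ‖(u : H)‖))
    (hτker : Dense (((LinearMap.ker τ).map D.subtype : Submodule ℝ H) : Set H))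
    (T : ℝ → H →L[ℝ] h)
    (hT : ∀ lam, ∀ hlam : ω < lam, ∀ w : H, T lam w = τ ⟨R lam w, hRmem lam hlam w⟩)
    (G : ℝ → h →L[ℝ] H)
    (hG : ∀ lam, G lam = ContinuousLinearMap.adjoint (T lam))
    (lam0 : ℝ) (hlam0 : ω < lam0)
    (Θ : Set (h × h)) (hΘ : MaximalMonotoneRelOfType 0 Θ) :
    ∀ (u0 : D) (ξ : h), (ξ, τ u0) ∈ Θ → ∀ v : D, τ v = 0 →
      ⟪A u0 - lam0 • G lam0 ξ, (v : H)⟫_ℝ = ⟪(u0 : H) + G lam0 ξ, A v⟫_ℝ := by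
  intro u0 ξ _ v hv
  have hTv : T lam0 (A v + lam0 • (v : H)) = 0 := by
    have hRv : (⟨R lam0 (A v + lam0 • (v : H)), hRmem lam0 hlam0 _⟩ : D) = v :=
      Subtype.ext (hRleft lam0 hlam0 v)
    rw [hT lam0 hlam0, hRv, hv]
  have hGv : ⟪G lam0 ξ, A v + lam0 • (v : H)⟫_ℝ = 0 := by
    rw [hG, ContinuousLinearMap.adjoint_inner_left, hTv, inner_zero_right]
  rw [inner_add_right, real_inner_smul_right] at hGv
  rw [inner_sub_left, inner_add_left, real_inner_smul_left, hAsym]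
  linarith
end
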